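/- arXiv:1503.04314 — 2 statements merged into one kernel-verified Lean document; each statement's English description precedes it below -/
import Mathlib

section
/- Let a0 ∈ ℝ, b0 > 0, t3 < t4 be reals, and let μ be a Borel probability measure on ℝ whose support is an infinite subset of [t3,t4]. Then there exist λ∞ ∈ ℂ with Im λ∞ ≥ 0, d ∈ ℝ, reals t1 < t2, and a nonzero finite Borel measure σ whose support is an infinite subset of [t1,t2], such that for every z ∈ ℂ with Im z > 0: (z − λ∞)(z − conj(λ∞)) = −(a0 − z + b0² ∫ dμ(t)/(t−z)) · (z + d + ∫ dσ(t)/(t−z)). (This is the direction (ii) ⇒ (i) of Theorem 1: the function m(z) = −1/(a0 − z + b0² ∫ dμ(t)/(t−z)) admits the representation m(z) = (z + d + ∫ dσ(t)/(t−z))/((z−λ∞)(z−conj λ∞)).) -/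
open MeasureTheory Complex Filter

/-- Cauchy transform of a Borel measure on ℝ, at a point `z` (defined off the support). -/
noncomputable def cauchyT (σ : Measure ℝ) (z : ℂ) : ℂ := ∫ t, ((t : ℂ) - z)⁻¹ ∂σ

/-- Topological support of a Borel measure on ℝ. -/
def msupport (σ : Measure ℝ) : Set ℝ := {x | ∀ U ∈ nhds x, σ U ≠ 0}

theorem ofReal_sub_ne_zero {z : ℂ} (hz : 0 < z.im) (t : ℝ) : (t : ℂ) - z ≠ 0 := by
  intro h
  have := congrArg Complex.im h
  simp at this
  exact hz.ne' this

theorem continuous_inv_ofReal_sub {z : ℂ} (hz : 0 < z.im) :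
    Continuous fun t : ℝ => ((t : ℂ) - z)⁻¹ :=
  Continuous.inv₀ (by fun_prop) (ofReal_sub_ne_zero hz)

theorem norm_inv_ofReal_sub_le {z : ℂ} (hz : 0 < z.im) (t : ℝ) :
    ‖((t : ℂ) - z)⁻¹‖ ≤ 1 / z.im := by
  rw [norm_inv, ← one_div]
  apply one_div_le_one_div_of_le hz
  calc z.im = |((t : ℂ) - z).im| := by simp [abs_of_pos hz]
    _ ≤ _ := abs_im_le_norm _

theorem integrable_inv_ofReal_sub (σ : Measure ℝ) [IsFiniteMeasure σ] {z : ℂ} (hz : 0 < z.im) :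
    Integrable (fun t : ℝ => ((t : ℂ) - z)⁻¹) σ :=
  Integrable.of_bound (continuous_inv_ofReal_sub hz).aestronglyMeasurable _
    (ae_of_all _ (norm_inv_ofReal_sub_le hz))

theorem cauchyT_im (σ : Measure ℝ) [IsFiniteMeasure σ] {z : ℂ} (hz : 0 < z.im) :
    (cauchyT σ z).im = ∫ t : ℝ, (((t : ℂ) - z)⁻¹).im ∂σ := by
  have := integral_im (𝕜 := ℂ) (integrable_inv_ofReal_sub σ hz)
  simp only [RCLike.im_to_complex] at this
  exact this.symm

theorem cauchyT_re (σ : Measure ℝ) [IsFiniteMeasure σ] {z : ℂ} (hz : 0 < z.im) :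
    (cauchyT σ z).re = ∫ t : ℝ, (((t : ℂ) - z)⁻¹).re ∂σ := by
  have := integral_re (𝕜 := ℂ) (integrable_inv_ofReal_sub σ hz)
  simp only [RCLike.re_to_complex] at this
  exact this.symm

theorem inv_ofReal_sub_im (z : ℂ) (t : ℝ) :
    (((t : ℂ) - z)⁻¹).im = z.im * ‖((t : ℂ) - z)⁻¹‖ ^ 2 := by
  rw [inv_im, norm_inv, inv_pow, ← normSq_eq_norm_sq]
  simp [div_eq_mul_inv]

theorem integrable_norm_inv_sq (σ : Measure ℝ) [IsFiniteMeasure σ] {z : ℂ} (hz : 0 < z.im) :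
    Integrable (fun t : ℝ => ‖((t : ℂ) - z)⁻¹‖ ^ 2) σ := by
  refine Integrable.of_bound
    ((continuous_inv_ofReal_sub hz).norm.pow 2).aestronglyMeasurable ((1 / z.im) ^ 2)
    (ae_of_all _ fun t => ?_)
  rw [norm_pow, norm_norm]
  gcongr
  exact norm_inv_ofReal_sub_le hz t

theorem cauchyT_im_eq (σ : Measure ℝ) [IsFiniteMeasure σ] {z : ℂ} (hz : 0 < z.im) :
    (cauchyT σ z).im = z.im * ∫ t : ℝ, ‖((t : ℂ) - z)⁻¹‖ ^ 2 ∂σ := by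
  rw [cauchyT_im σ hz, ← integral_const_mul]
  simp only [inv_ofReal_sub_im]

theorem integral_norm_inv_sq_pos (σ : Measure ℝ) [IsProbabilityMeasure σ] {z : ℂ}
    (hz : 0 < z.im) : 0 < ∫ t : ℝ, ‖((t : ℂ) - z)⁻¹‖ ^ 2 ∂σ := by
  rw [integral_pos_iff_support_of_nonneg (fun t => by positivity) (integrable_norm_inv_sq σ hz)]
  have : Function.support (fun t : ℝ => ‖((t : ℂ) - z)⁻¹‖ ^ 2) = Set.univ := by
    ext t
    simp [ofReal_sub_ne_zero hz t]
  rw [this]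
  simp

theorem cauchyT_im_pos (σ : Measure ℝ) [IsProbabilityMeasure σ] {z : ℂ} (hz : 0 < z.im) :
    0 < (cauchyT σ z).im := by
  rw [cauchyT_im_eq σ hz]
  exact mul_pos hz (integral_norm_inv_sq_pos σ hz)

open scoped InnerProductSpace in
theorem exists_spectralMeasure {H : Type*} [NormedAddCommGroup H] [InnerProductSpace ℂ H]
    [CompleteSpace H] (A : H →L[ℂ] H) (hA : IsSelfAdjoint A) (u : H) :
    ∃ σ : Measure ℝ, IsFiniteMeasure σ ∧ σ (spectrum ℝ A)ᶜ = 0 ∧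
      ∀ f : ℝ → ℝ, Continuous f → ∫ t, f t ∂σ = (⟪u, cfc f A u⟫_ℂ).re := by
  let L : CompactlySupportedContinuousMap (spectrum ℝ A) ℝ →ₗ[ℝ] ℝ :=
    { toFun := fun f => (⟪u, cfcHom hA (R := ℝ) (f : C(spectrum ℝ A, ℝ)) u⟫_ℂ).re
      map_add' := by
        intro f g
        have : ((f + g : CompactlySupportedContinuousMap (spectrum ℝ A) ℝ) :
          C(spectrum ℝ A, ℝ)) = (f : C(spectrum ℝ A, ℝ)) + g := rfl
        rw [this, map_add]
        simp
      map_smul' := by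
        intro c f
        have : ((c • f : CompactlySupportedContinuousMap (spectrum ℝ A) ℝ) :
          C(spectrum ℝ A, ℝ)) = c • (f : C(spectrum ℝ A, ℝ)) := rfl
        rw [this, map_smul]
        simp [inner_smul_right_eq_smul] }
  have hL : ∀ f, 0 ≤ f → 0 ≤ L f := by
    intro f hf
    have h1 : 0 ≤ cfcHom hA (R := ℝ) (f : C(spectrum ℝ A, ℝ)) := by
      rw [cfcHom_nonneg_iff hA]
      exact hf
    rw [ContinuousLinearMap.nonneg_iff_isPositive] at h1
    exact h1.re_inner_nonneg_right u
  let Λ := PositiveLinearMap.mk₀ L hL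
  refine ⟨(RealRMK.rieszMeasure Λ).map Subtype.val, inferInstance, ?_, ?_⟩
  · rw [Measure.map_apply (by fun_prop) (spectrum.isClosed A).measurableSet.compl]
    simp
  · intro f hf
    have := RealRMK.integral_rieszMeasure Λ (CompactlySupportedContinuousMap.continuousMapEquiv
      (⟨fun x => f x, by fun_prop⟩ : C(spectrum ℝ A, ℝ)))
    rw [integral_map (by fun_prop) (by fun_prop), cfc_apply f A hA hf.continuousOn]
    exact this

open scoped InnerProductSpace in
theorem inner_eq_integral_resolvent {H : Type*} [NormedAddCommGroup H] [InnerProductSpace ℂ H]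
    [CompleteSpace H] (A : H →L[ℂ] H) (hA : IsSelfAdjoint A) (u : H) (σ : Measure ℝ)
    [IsFiniteMeasure σ]
    (hσ : ∀ f : ℝ → ℝ, Continuous f → ∫ t, f t ∂σ = (⟪u, cfc f A u⟫_ℂ).re)
    (z : ℂ) (hz : 0 < z.im) (v : H) (hv : A v - z • v = u) :
    ⟪u, v⟫_ℂ = cauchyT σ z := by
  have hgc := continuous_inv_ofReal_sub hz
  obtain ⟨r, hr⟩ : ∃ r : ℝ → ℝ, ∀ t : ℝ, r t = ((t : ℂ) - z)⁻¹.re := ⟨_, fun _ => rfl⟩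
  obtain ⟨s, hs⟩ : ∃ s : ℝ → ℝ, ∀ t : ℝ, s t = ((t : ℂ) - z)⁻¹.im := ⟨_, fun _ => rfl⟩
  have hrc : Continuous r := by
    rw [funext hr]; exact continuous_re.comp hgc
  have hsc : Continuous s := by
    rw [funext hs]; exact continuous_im.comp hgc
  have hmul : ∀ t : ℝ, r t * t = 1 + z.re * r t - z.im * s t ∧
      s t * t = z.re * s t + z.im * r t := by
    intro t
    have h := inv_mul_cancel₀ (ofReal_sub_ne_zero hz t)
    have h1 := congrArg Complex.re h
    have h2 := congrArg Complex.im h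
    rw [mul_re, ← hr, ← hs] at h1
    rw [mul_im, ← hr, ← hs] at h2
    simp only [sub_re, ofReal_re, sub_im, ofReal_im, one_re, one_im] at h1 h2
    constructor <;> linarith
  have hre : (cauchyT σ z).re = ∫ t, r t ∂σ := by
    simp only [cauchyT_re σ hz, hr]
  have him : (cauchyT σ z).im = ∫ t, s t ∂σ := by
    simp only [cauchyT_im σ hz, hs]
  have hsa : ∀ f : ℝ → ℝ, (⟪u, cfc f A u⟫_ℂ).im = 0 := by
    intro f
    have : IsSelfAdjoint (cfc f A) := cfc_predicate f A
    exact this.isSymmetric.im_inner_self_apply u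
  have e1 : cfc r A * A = 1 + z.re • cfc r A - z.im • cfc s A := by
    have : cfc r A * A = cfc (fun t => r t * t) A := by
      rw [cfc_mul r (fun t => t) A hrc.continuousOn, cfc_id' ℝ A]
    rw [this, funext fun t => (hmul t).1,
      cfc_sub (fun t => 1 + z.re * r t) (fun t => z.im * s t) A (by fun_prop) (by fun_prop),
      cfc_const_add 1 (fun t => z.re * r t) A (by fun_prop), cfc_const_mul _ _ _ (by fun_prop),
      cfc_const_mul _ _ _ (by fun_prop), map_one]
  have e2 : cfc s A * A = z.re • cfc s A + z.im • cfc r A := by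
    have : cfc s A * A = cfc (fun t => s t * t) A := by
      rw [cfc_mul s (fun t => t) A hsc.continuousOn, cfc_id' ℝ A]
    rw [this, funext fun t => (hmul t).2,
      cfc_add A (fun t => z.re * s t) (fun t => z.im * r t) (by fun_prop) (by fun_prop),
      cfc_const_mul _ _ _ (by fun_prop), cfc_const_mul _ _ _ (by fun_prop)]
  have hR : v = cfc r A u + I • cfc s A u := by
    have e1v : cfc r A (A v) = v + (z.re : ℂ) • cfc r A v - (z.im : ℂ) • cfc s A v := by
      simpa using congrArg (fun B : H →L[ℂ] H => B v) e1
    have e2v : cfc s A (A v) = (z.re : ℂ) • cfc s A v + (z.im : ℂ) • cfc r A v := by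
      simpa using congrArg (fun B : H →L[ℂ] H => B v) e2
    rw [← hv, map_sub, map_sub, map_smul, map_smul, e1v, e2v]
    have hz' := re_add_im z
    generalize (z.re : ℂ) = x at *
    generalize (z.im : ℂ) = y at *
    subst hz'
    match_scalars
    · ring
    · ring
    · linear_combination y * I_sq
  rw [hR, inner_add_right, inner_smul_right]
  apply Complex.ext
  · simp [hre, hσ r hrc, hsa]
  · simp [him, hσ s hsc, hsa]

theorem memLp_of_continuous {ν : Measure ℝ} [IsFiniteMeasure ν] {K : Set ℝ} (hK : IsCompact K)
    (hν : ν Kᶜ = 0) {f : ℝ → ℂ} (hf : Continuous f) (p : ENNReal) : MemLp f p ν := by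
  obtain ⟨C, hC⟩ := hK.exists_bound_of_continuousOn hf.continuousOn
  refine MemLp.of_bound hf.aestronglyMeasurable C ?_
  filter_upwards [mem_ae_iff.2 hν] with t ht using hC t ht

open scoped InnerProductSpace in
theorem exists_mulOperator (ν : Measure ℝ) [IsProbabilityMeasure ν] {K : Set ℝ}
    (hK : IsCompact K) (hν : ν Kᶜ = 0) :
    ∃ (J : C(ℝ, ℂ) →ₗ[ℂ] Lp ℂ 2 ν) (T : Lp ℂ 2 ν →L[ℂ] Lp ℂ 2 ν),
      IsSelfAdjoint T ∧ (∀ f g : C(ℝ, ℂ), (∀ t : ℝ, f t = t * g t) → T (J g) = J f) ∧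
      (∀ f g, ⟪J f, J g⟫_ℂ = ∫ t, (starRingEnd ℂ) (f t) * g t ∂ν) ∧
      (∀ f, J f = 0 → f =ᵐ[ν] 0) := by
  have hm : ∀ (f : C(ℝ, ℂ)) (p : ENNReal), MemLp f p ν := fun f p =>
    memLp_of_continuous hK hν f.continuous p
  let J : C(ℝ, ℂ) →ₗ[ℂ] Lp ℂ 2 ν :=
    { toFun := fun f => (hm f 2).toLp f
      map_add' := fun f g => rfl
      map_smul' := fun c f => rfl }
  let idC : C(ℝ, ℂ) := ⟨fun t => (t : ℂ), by fun_prop⟩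
  have hJ : ∀ f : C(ℝ, ℂ), J f =ᵐ[ν] f := fun f => (hm f 2).coeFn_toLp
  let T : Lp ℂ 2 ν →L[ℂ] Lp ℂ 2 ν :=
    (ContinuousLinearMap.mul ℂ ℂ).holderL ν ⊤ 2 2 ((hm idC ⊤).toLp idC)
  have hT : ∀ v : Lp ℂ 2 ν, T v =ᵐ[ν] fun t => (t : ℂ) * v t := by
    intro v
    have h1 := (ContinuousLinearMap.mul ℂ ℂ).coeFn_holder (r := 2) ((hm idC ⊤).toLp idC) v
    have h2 := (hm idC ⊤).coeFn_toLp
    filter_upwards [h1, h2] with t h1 h2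
    refine h1.trans ?_
    rw [h2]
    rfl
  refine ⟨J, T, ?_, ?_, ?_, ?_⟩
  · rw [ContinuousLinearMap.isSelfAdjoint_iff_isSymmetric]
    intro v w
    simp only [ContinuousLinearMap.coe_coe, L2.inner_def]
    apply integral_congr_ae
    filter_upwards [hT v, hT w] with t h1 h2
    rw [h1, h2]
    simp
    ring
  · intro f g hfg
    apply Lp.ext
    filter_upwards [hT (J g), hJ f, hJ g] with t h1 h2 h3
    rw [h1, h2, h3, hfg]
  · intro f g
    rw [L2.inner_def]
    apply integral_congr_ae
    filter_upwards [hJ f, hJ g] with t h1 h2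
    rw [h1, h2]
    simp [mul_comm]
  · intro f hf
    have := hJ f
    rw [hf] at this
    exact this.symm.trans (Lp.coeFn_zero _ _ _)

open scoped InnerProductSpace in
/-- Compressing multiplication by the variable to the orthogonal complement of the constants. -/
theorem exists_compression (ν : Measure ℝ) [IsProbabilityMeasure ν] {K : Set ℝ}
    (hK : IsCompact K) (hν : ν Kᶜ = 0) :
    ∃ (H : Type) (_ : NormedAddCommGroup H) (_ : InnerProductSpace ℂ H) (_ : CompleteSpace H)
      (J : C(ℝ, ℂ) →ₗ[ℂ] H) (A : H →L[ℂ] H),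
      IsSelfAdjoint A ∧
      (∀ f g : C(ℝ, ℂ), ∫ t, g t ∂ν = 0 → (∀ t : ℝ, f t = t * g t - ∫ s : ℝ, s * g s ∂ν) →
        A (J g) = J f) ∧
      (∀ f g : C(ℝ, ℂ), ⟪J f, J g⟫_ℂ = ∫ t, (starRingEnd ℂ) (f t) * g t ∂ν) ∧
      (∀ f : C(ℝ, ℂ), J f = 0 → f =ᵐ[ν] 0) := by
  obtain ⟨J, T, hT, hTJ, hJ, hJ0⟩ := exists_mulOperator ν hK hν
  set e := J 1 with he
  have he1 : ‖e‖ = 1 := by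
    have h : ⟪e, e⟫_ℂ = 1 := by
      rw [he, hJ]
      simp
    have h' := inner_self_eq_norm_sq (𝕜 := ℂ) e
    rw [h, RCLike.one_re] at h'
    nlinarith [norm_nonneg e]
  set P : Lp ℂ 2 ν →L[ℂ] Lp ℂ 2 ν := 1 - (Submodule.span ℂ {e}).starProjection with hP
  have hPsa : IsSelfAdjoint P := (IsSelfAdjoint.one _).sub (isSelfAdjoint_starProjection _)
  have hPJ : ∀ f g : C(ℝ, ℂ), (∀ t, f t = g t - ∫ s, g s ∂ν) → P (J g) = J f := by
    intro f g hfg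
    have : f = g - (∫ s, g s ∂ν) • (1 : C(ℝ, ℂ)) := by
      ext t
      simp [hfg]
    rw [hP, this, map_sub, map_smul, ← he]
    simp only [sub_apply, one_apply_eq_self]
    rw [Submodule.starProjection_unit_singleton ℂ he1, he, hJ]
    simp
  refine ⟨Lp ℂ 2 ν, inferInstance, inferInstance, inferInstance, J, P * T * P, ?_, ?_, hJ, hJ0⟩
  · have := hT.conjugate P
    rwa [hPsa.star_eq] at this
  · intro f g hg hfg
    let h : C(ℝ, ℂ) := ⟨fun t => t * g t, by fun_prop⟩
    simp only [mul_apply_eq_comp]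
    rw [hPJ g g (by simp [hg]), hTJ h g (fun t => rfl), hPJ f h hfg]

open scoped InnerProductSpace Polynomial in
/-- Coefficient stripping. -/
theorem exists_cauchyT_mul_eq_neg_one (ν : Measure ℝ) [IsProbabilityMeasure ν] {K : Set ℝ}
    (hK : IsCompact K) (hν : ν Kᶜ = 0) (hinf : ∀ S : Set ℝ, S.Finite → ν Sᶜ ≠ 0) :
    ∃ (d : ℝ) (σ : Measure ℝ) (L : Set ℝ), IsFiniteMeasure σ ∧ IsCompact L ∧ σ Lᶜ = 0 ∧
      (∀ S : Set ℝ, S.Finite → σ Sᶜ ≠ 0) ∧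
      ∀ z : ℂ, 0 < z.im → cauchyT ν z * (z + d + cauchyT σ z) = -1 := by
  obtain ⟨H, _, _, _, J, A, hA, hAJ, hJ, hJ0⟩ := exists_compression ν hK hν
  have hgi : ∀ f : ℝ → ℂ, Continuous f → Integrable f ν := fun f hf =>
    memLp_one_iff_integrable.1 (memLp_of_continuous hK hν hf 1)
  obtain ⟨m, hm⟩ : ∃ m : ℝ, ∫ t : ℝ, (t : ℂ) ∂ν = m := ⟨_, integral_ofReal⟩
  let u₀ : C(ℝ, ℂ) := ⟨fun t => (t : ℂ) - m, by fun_prop⟩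
  obtain ⟨σ, hσfin, hσsupp, hσ⟩ := exists_spectralMeasure A hA (J u₀)
  refine ⟨-m, σ, spectrum ℝ A, hσfin, spectrum.isCompact A, hσsupp, ?_, ?_⟩
  · intro S hS hS0
    have key : ∀ s : Finset ℝ, ∃ q : ℂ[X], q.Monic ∧ 0 < q.natDegree ∧
        ∫ t : ℝ, q.eval (t : ℂ) ∂ν = 0 ∧
        ∀ f : C(ℝ, ℂ), (∀ t : ℝ, f t = q.eval (t : ℂ)) →
          cfc (fun t : ℝ => ∏ a ∈ s, (t - a)) A (J u₀) = J f := by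
      intro s
      induction s using Finset.induction_on with
      | empty =>
        refine ⟨Polynomial.X - Polynomial.C (m : ℂ), Polynomial.monic_X_sub_C _, by simp, ?_, ?_⟩
        · have : ∫ t : ℝ, ((t : ℂ) - m) ∂ν = 0 := by
            rw [integral_sub (hgi _ (by fun_prop)) (hgi _ (by fun_prop)), hm]
            simp
          simpa using this
        · intro f hf
          have : f = u₀ := by
            ext t
            simp [hf, u₀]
          simp [this, cfc_const_one ℝ A]
      | insert a s ha ih =>
        obtain ⟨q, hq, hdeg, hq0, hqJ⟩ := ih
        have hqc : Continuous fun t : ℝ => q.eval (t : ℂ) := by fun_prop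
        set c := ∫ t : ℝ, (t : ℂ) * q.eval (t : ℂ) ∂ν with hc
        have hmon := (Polynomial.monic_X_sub_C (a : ℂ)).mul hq
        have hnd : 0 < ((Polynomial.X - Polynomial.C (a : ℂ)) * q).natDegree := by
          rw [(Polynomial.monic_X_sub_C (a : ℂ)).natDegree_mul hq]
          omega
        refine ⟨(Polynomial.X - Polynomial.C (a : ℂ)) * q - Polynomial.C c, ?_, ?_, ?_, ?_⟩
        · exact hmon.sub_of_left (Polynomial.degree_C_le.trans_lt
            (Polynomial.natDegree_pos_iff_degree_pos.1 hnd))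
        · rwa [Polynomial.natDegree_sub_C]
        · have e : ∀ t : ℝ, ((Polynomial.X - Polynomial.C (a : ℂ)) * q - Polynomial.C c).eval (t : ℂ)
              = t * q.eval (t : ℂ) - a * q.eval (t : ℂ) - c := by
            intro t
            simp
            ring
          simp only [e]
          rw [integral_sub (hgi _ (by fun_prop)) (hgi _ (by fun_prop)),
            integral_sub (hgi _ (by fun_prop)) (hgi _ (by fun_prop)), integral_const_mul, hq0,
            ← hc]
          simp
        · intro f hf
          let g : C(ℝ, ℂ) := ⟨fun t => q.eval (t : ℂ), hqc⟩
          let h : C(ℝ, ℂ) := ⟨fun t => t * q.eval (t : ℂ) - c, by fun_prop⟩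
          have hg := hqJ g (fun t => rfl)
          have hfg : f = h - (a : ℂ) • g := by
            ext t
            simp [hf, h, g]
            ring
          have hcf : cfc (fun t : ℝ => ∏ b ∈ insert a s, (t - b)) A
              = (A - a • (1 : H →L[ℂ] H)) * cfc (fun t : ℝ => ∏ b ∈ s, (t - b)) A := by
            simp only [Finset.prod_insert ha]
            rw [cfc_mul (fun t => t - a) (fun t : ℝ => ∏ b ∈ s, (t - b)) A (by fun_prop)
              (by fun_prop), cfc_sub (fun t => t) (fun _ => a) A (by fun_prop) (by fun_prop), cfc_id' ℝ A,
              cfc_const a A, Algebra.algebraMap_eq_smul_one]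
          rw [hcf, mul_apply_eq_comp, hg, hfg, map_sub, map_smul]
          have := hAJ h g hq0 (fun t => rfl)
          simp [this]
    obtain ⟨q, hq, -, -, hqJ⟩ := key hS.toFinset
    let g : C(ℝ, ℂ) := ⟨fun t => q.eval (t : ℂ), by fun_prop⟩
    have hg := hqJ g (fun t => rfl)
    set p : ℝ → ℝ := fun t : ℝ => ∏ b ∈ hS.toFinset, (t - b) with hp
    have hpc : Continuous p := by fun_prop
    have h1 : ∫ t, p t * p t ∂σ = 0 := by
      apply integral_eq_zero_of_ae
      filter_upwards [mem_ae_iff.2 hS0] with t ht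
      have : p t = 0 := Finset.prod_eq_zero (hS.mem_toFinset.2 ht) (sub_self t)
      simp [this]
    have h2 : J g = 0 := by
      have hsa : IsSelfAdjoint (cfc p A) := cfc_predicate p A
      rw [hσ (fun t => p t * p t) (hpc.mul hpc), cfc_mul p p A hpc.continuousOn hpc.continuousOn,
        mul_apply_eq_comp, ← hsa.isSymmetric.apply_clm, hg] at h1
      have h3 := inner_self_eq_norm_sq (𝕜 := ℂ) (J g)
      rw [RCLike.re_to_complex, h1] at h3
      simpa using h3.symm
    refine hinf {t : ℝ | q.eval (t : ℂ) = 0} ?_ (mem_ae_iff.1 (hJ0 g h2))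
    have hfin := Polynomial.finite_setOfPred_isRoot hq.ne_zero
    exact hfin.preimage Complex.ofReal_injective.injOn
  · intro z hz
    have hM0 : cauchyT ν z ≠ 0 := by
      intro h
      have := cauchyT_im_pos ν hz
      simp [h] at this
    have hrc := continuous_inv_ofReal_sub hz
    have hne := ofReal_sub_ne_zero hz
    set M := cauchyT ν z with hM
    let f : C(ℝ, ℂ) := ⟨fun t => 1 - M⁻¹ * ((t : ℂ) - z)⁻¹, by fun_prop⟩
    have hf0 : ∫ t, f t ∂ν = 0 := by
      change ∫ t : ℝ, (1 - M⁻¹ * ((t : ℂ) - z)⁻¹) ∂ν = 0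
      rw [integral_sub (hgi _ (by fun_prop)) (hgi _ (by fun_prop)), integral_const_mul]
      change _ - _ * cauchyT ν z = 0
      rw [← hM]
      simp [hM0]
    have htf : ∀ t : ℝ, (t : ℂ) * f t = t - z - M⁻¹ + z * f t := by
      intro t
      change (t : ℂ) * (1 - M⁻¹ * ((t : ℂ) - z)⁻¹) = t - z - M⁻¹ + z * (1 - M⁻¹ * ((t : ℂ) - z)⁻¹)
      have := hne t
      field_simp
      ring
    have hf1 : ∫ t : ℝ, (t : ℂ) * f t ∂ν = m - z - M⁻¹ := by
      simp only [htf]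
      rw [integral_add (hgi _ (by fun_prop)) (hgi _ (by fun_prop)), integral_const_mul, hf0,
        integral_sub (hgi _ (by fun_prop)) (hgi _ (by fun_prop)),
        integral_sub (hgi _ (by fun_prop)) (hgi _ (by fun_prop)), hm]
      simp
    have hAf : A (J f) - z • J f = J u₀ := by
      rw [hAJ (u₀ + z • f) f hf0, map_add, map_smul, add_sub_cancel_right]
      intro t
      rw [hf1, htf]
      simp [u₀]
      ring
    have hres := inner_eq_integral_resolvent A hA (J u₀) σ hσ z hz (J f) hAf
    have huf : ⟪J u₀, J f⟫_ℂ = m - z - M⁻¹ := by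
      rw [hJ]
      have : ∀ t : ℝ, (starRingEnd ℂ) (u₀ t) * f t = t * f t - m * f t := by
        intro t
        simp [u₀]
        ring
      simp only [this]
      rw [integral_sub (hgi _ (by fun_prop)) (hgi _ (by fun_prop)), hf1, integral_const_mul, hf0]
      simp
    rw [← hres, huf]
    push_cast
    field_simp
    ring

theorem sq_integral_mul_le {α : Type*} [MeasurableSpace α] {μ : Measure α} {f g : α → ℝ}
    (hf : Integrable (fun x => f x ^ 2) μ) (hg : Integrable (fun x => g x ^ 2) μ)
    (hfg : Integrable (fun x => f x * g x) μ) :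
    (∫ x, f x * g x ∂μ) ^ 2 ≤ (∫ x, f x ^ 2 ∂μ) * ∫ x, g x ^ 2 ∂μ := by
  have key : ∀ s : ℝ, 0 ≤ (∫ x, g x ^ 2 ∂μ) * (s * s) + (-2 * ∫ x, f x * g x ∂μ) * s +
      ∫ x, f x ^ 2 ∂μ := by
    intro s
    have h : 0 ≤ ∫ x, (s * s) * g x ^ 2 + (-2 * s) * (f x * g x) + f x ^ 2 ∂μ :=
      integral_nonneg fun x => by
        have := sq_nonneg (s * g x - f x)
        simp only [Pi.zero_apply]
        linarith
    have h1 : Integrable (fun x => s * s * g x ^ 2) μ := hg.const_mul _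
    have h2 : Integrable (fun x => -2 * s * (f x * g x)) μ := hfg.const_mul _
    have h3 : Integrable (fun x => s * s * g x ^ 2 + -2 * s * (f x * g x)) μ := h1.add h2
    rw [integral_add h3 hf, integral_add h1 h2, integral_const_mul,
      integral_const_mul] at h
    linarith
  have := discrim_le_zero key
  rw [discrim] at this
  linarith

theorem integrable_inv_of_norm_sq {μ : Measure ℝ} [IsFiniteMeasure μ] {z : ℂ}
    (hz : Integrable (fun t : ℝ => ‖((t : ℂ) - z)⁻¹‖ ^ 2) μ) :
    Integrable (fun t : ℝ => ((t : ℂ) - z)⁻¹) μ := by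
  refine ((integrable_const (1 : ℝ)).add hz).mono' (by fun_prop) (ae_of_all _ fun t => ?_)
  simp only [Pi.add_apply]
  nlinarith [sq_nonneg (‖((t : ℂ) - z)⁻¹‖ - 1), norm_nonneg ((t : ℂ) - z)⁻¹]

theorem norm_cauchyT_sub_sq_le {μ : Measure ℝ} [IsFiniteMeasure μ] {z w : ℂ}
    (hz : Integrable (fun t : ℝ => ‖((t : ℂ) - z)⁻¹‖ ^ 2) μ)
    (hw : Integrable (fun t : ℝ => ‖((t : ℂ) - w)⁻¹‖ ^ 2) μ)
    (hz0 : ∀ᵐ t : ℝ ∂μ, (t : ℂ) - z ≠ 0) (hw0 : ∀ᵐ t : ℝ ∂μ, (t : ℂ) - w ≠ 0) :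
    ‖cauchyT μ z - cauchyT μ w‖ ^ 2 ≤ ‖z - w‖ ^ 2 *
      ((∫ t : ℝ, ‖((t : ℂ) - z)⁻¹‖ ^ 2 ∂μ) * ∫ t : ℝ, ‖((t : ℂ) - w)⁻¹‖ ^ 2 ∂μ) := by
  have hzw : Integrable (fun t : ℝ => ‖((t : ℂ) - z)⁻¹‖ * ‖((t : ℂ) - w)⁻¹‖) μ := by
    refine (hz.add hw).mono' (by fun_prop) (ae_of_all _ fun t => ?_)
    rw [Real.norm_of_nonneg (by positivity)]
    simp only [Pi.add_apply]
    nlinarith [sq_nonneg (‖((t : ℂ) - z)⁻¹‖ - ‖((t : ℂ) - w)⁻¹‖),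
      norm_nonneg ((t : ℂ) - z)⁻¹, norm_nonneg ((t : ℂ) - w)⁻¹]
  have h1 : cauchyT μ z - cauchyT μ w =
      ∫ t : ℝ, (z - w) * (((t : ℂ) - z)⁻¹ * ((t : ℂ) - w)⁻¹) ∂μ := by
    rw [cauchyT, cauchyT, ← integral_sub (integrable_inv_of_norm_sq hz)
      (integrable_inv_of_norm_sq hw)]
    apply integral_congr_ae
    filter_upwards [hz0, hw0] with t h h'
    field_simp
    ring
  have h2 : ‖cauchyT μ z - cauchyT μ w‖ ≤
      ‖z - w‖ * ∫ t : ℝ, ‖((t : ℂ) - z)⁻¹‖ * ‖((t : ℂ) - w)⁻¹‖ ∂μ := by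
    rw [h1, integral_const_mul, norm_mul]
    gcongr
    refine (norm_integral_le_integral_norm _).trans_eq ?_
    simp only [norm_mul]
  calc _ ≤ (‖z - w‖ * ∫ t : ℝ, ‖((t : ℂ) - z)⁻¹‖ * ‖((t : ℂ) - w)⁻¹‖ ∂μ) ^ 2 := by gcongr
    _ ≤ _ := by
      rw [mul_pow]
      gcongr
      exact sq_integral_mul_le hz hw hzw

theorem continuousOn_cauchyT (μ : Measure ℝ) [IsFiniteMeasure μ] {ε : ℝ} (hε : 0 < ε) :
    ContinuousOn (cauchyT μ) {z | ε ≤ z.im} := by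
  refine continuousOn_of_dominated (bound := fun _ => 1 / ε) (fun z hz => by fun_prop)
    (fun z hz => ae_of_all _ fun t => ?_) (integrable_const _) (ae_of_all _ fun t => ?_)
  · exact (norm_inv_ofReal_sub_le (hε.trans_le hz) t).trans (one_div_le_one_div_of_le hε hz)
  · exact ContinuousOn.inv₀ (by fun_prop) fun z hz => ofReal_sub_ne_zero (hε.trans_le hz) t

theorem exists_fixedPoint_of_pos (μ : Measure ℝ) [IsProbabilityMeasure μ] (a : ℝ) {β ε : ℝ}
    (hβ : 0 < β) (hε : 0 < ε) :
    ∃ w : ℂ, 0 < w.im ∧ a + ε * I + β * cauchyT μ w = w := by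
  set φ : ℂ → ℂ := fun z => a + ε * I + β * cauchyT μ z with hφ
  set N : ℂ → ℝ := fun z => ∫ t : ℝ, ‖((t : ℂ) - z)⁻¹‖ ^ 2 ∂μ with hN
  have him : ∀ z : ℂ, 0 < z.im → (φ z).im = ε + β * (z.im * N z) := by
    intro z hz
    simp [hφ, cauchyT_im_eq μ hz, hN]
  have hNpos : ∀ z : ℂ, 0 < z.im → 0 < N z := fun z hz => integral_norm_inv_sq_pos μ hz
  set R := |a| + ε + β * (1 / ε) with hR
  set K : Set ℂ := {z | ε ≤ z.im} ∩ Metric.closedBall 0 R with hK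
  have hmaps : ∀ z : ℂ, ε ≤ z.im → φ z ∈ K := by
    intro z hz
    have hz0 := hε.trans_le hz
    constructor
    · have := mul_pos hβ (mul_pos hz0 (hNpos z hz0))
      simp only [Set.mem_ofPred_eq, him z hz0]
      linarith
    · rw [mem_closedBall_zero_iff]
      have hM : ‖cauchyT μ z‖ ≤ 1 / ε := by
        have := norm_integral_le_of_norm_le_const (μ := μ) (C := 1 / ε)
          (f := fun t : ℝ => ((t : ℂ) - z)⁻¹) (ae_of_all _ fun t =>
          (norm_inv_ofReal_sub_le hz0 t).trans (one_div_le_one_div_of_le hε hz))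
        simpa [cauchyT] using this
      calc ‖φ z‖ ≤ ‖(a : ℂ)‖ + ‖ε * I‖ + ‖β * cauchyT μ z‖ := norm_add₃_le
        _ = |a| + ε + β * ‖cauchyT μ z‖ := by
          simp [abs_of_pos hε, abs_of_pos hβ]
        _ ≤ R := by rw [hR]; gcongr
  have hKc : IsCompact K := (isCompact_closedBall 0 R).inter_left
    (isClosed_le continuous_const continuous_im)
  have hKne : K.Nonempty := ⟨φ (ε * I), hmaps _ (by simp)⟩
  have hφc : ContinuousOn φ K := by
    have := (continuousOn_cauchyT μ hε).mono (Set.inter_subset_left (t := Metric.closedBall 0 R))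
    exact continuousOn_const.add (continuousOn_const.mul this)
  have hfc : ContinuousOn (fun z => ‖φ z - z‖ ^ 2 / ((φ z).im * z.im)) K := by
    refine ContinuousOn.div ((hφc.sub continuousOn_id).norm.pow 2)
      ((continuous_im.comp_continuousOn hφc).mul continuous_im.continuousOn) fun z hz => ?_
    have h1 := hε.trans_le hz.1
    have h2 := hε.trans_le (hmaps z hz.1).1
    exact (mul_pos h2 h1).ne'
  obtain ⟨z, hzK, hmin⟩ := hKc.exists_isMinOn hKne hfc
  have hzi := hε.trans_le hzK.1
  refine ⟨z, hzi, ?_⟩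
  by_contra hne
  set w := φ z with hw
  have hwK : w ∈ K := hmaps z hzK.1
  have hwi : 0 < w.im := hε.trans_le hwK.1
  have hφwi : 0 < (φ w).im := hε.trans_le (hmaps w hwK.1).1
  have hpos : 0 < ‖w - z‖ ^ 2 := by
    have : w - z ≠ 0 := sub_ne_zero.2 hne
    positivity
  have h1 : ‖w - z‖ ^ 2 / (w.im * z.im) ≤ ‖φ w - w‖ ^ 2 / ((φ w).im * w.im) := hmin hwK
  have h2 : ‖φ w - w‖ ^ 2 ≤ ‖w - z‖ ^ 2 * ((β * N w) * (β * N z)) := by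
    have h := norm_cauchyT_sub_sq_le (integrable_norm_inv_sq μ hwi) (integrable_norm_inv_sq μ hzi)
      (ae_of_all _ (ofReal_sub_ne_zero hwi)) (ae_of_all _ (ofReal_sub_ne_zero hzi))
    have e : φ w - w = β * (cauchyT μ w - cauchyT μ z) := by
      have : w = a + ε * I + β * cauchyT μ z := hw
      nth_rewrite 2 [this]
      simp only [hφ]
      ring
    rw [e, norm_mul, mul_pow, norm_real, Real.norm_of_nonneg hβ.le]
    calc β ^ 2 * ‖cauchyT μ w - cauchyT μ z‖ ^ 2 ≤ β ^ 2 * (‖w - z‖ ^ 2 * (N w * N z)) := by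
          gcongr
      _ = _ := by ring
  have h3 : β * N w < (φ w).im / w.im := by
    rw [lt_div_iff₀ hwi, him w hwi]
    linarith
  have h4 : β * N z < w.im / z.im := by
    rw [lt_div_iff₀ hzi, hw, him z hzi]
    linarith
  have h5 : ‖φ w - w‖ ^ 2 < ‖w - z‖ ^ 2 * ((φ w).im / w.im * (w.im / z.im)) := by
    refine h2.trans_lt (mul_lt_mul_of_pos_left ?_ hpos)
    have := hNpos w hwi
    have := hNpos z hzi
    exact mul_lt_mul'' h3 h4 (by positivity) (by positivity)
  rw [div_le_div_iff₀ (by positivity) (by positivity)] at h1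
  have h6 : ‖w - z‖ ^ 2 * ((φ w).im / w.im * (w.im / z.im)) * (w.im * z.im) =
      ‖w - z‖ ^ 2 * ((φ w).im * w.im) := by
    field_simp
  have h7 := mul_lt_mul_of_pos_right h5 (mul_pos hwi hzi)
  linarith

/-- A Denjoy–Wolff point of the self-map `z ↦ a + β * cauchyT μ z` of the upper half-plane. -/
theorem exists_denjoyWolff_point (μ : Measure ℝ) [IsProbabilityMeasure μ] (a : ℝ) {β : ℝ}
    (hβ : 0 < β) :
    ∃ l : ℂ, 0 ≤ l.im ∧ (∀ᵐ t : ℝ ∂μ, (t : ℂ) - l ≠ 0) ∧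
      Integrable (fun t : ℝ => ‖((t : ℂ) - l)⁻¹‖ ^ 2) μ ∧
      β * ∫ t : ℝ, ‖((t : ℂ) - l)⁻¹‖ ^ 2 ∂μ ≤ 1 ∧ a + β * cauchyT μ l = l := by
  set N : ℂ → ℝ := fun z => ∫ t : ℝ, ‖((t : ℂ) - z)⁻¹‖ ^ 2 ∂μ with hN
  set ε : ℕ → ℝ := fun n => 1 / ((n : ℝ) + 1) with hε
  have hεpos : ∀ n, 0 < ε n := fun n => Nat.one_div_pos_of_nat
  have hε1 : ∀ n, ε n ≤ 1 := by
    intro n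
    rw [hε]
    apply div_le_one_of_le₀ <;> linarith [(Nat.cast_nonneg n : (0 : ℝ) ≤ n)]
  choose w hwi hw using fun n => exists_fixedPoint_of_pos μ a hβ (hεpos n)
  have hNle : ∀ n, N (w n) ≤ 1 / β := by
    intro n
    have h := congrArg Complex.im (hw n)
    have hN' : N (w n) = ∫ t : ℝ, ‖((t : ℂ) - w n)⁻¹‖ ^ 2 ∂μ := rfl
    rw [add_im, add_im, im_ofReal_mul, im_ofReal_mul, cauchyT_im_eq μ (hwi n), ← hN'] at h
    simp only [ofReal_im, I_im, mul_one, zero_add] at h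
    rw [le_div_iff₀ hβ]
    have h1 := hεpos n
    have h2 : (w n).im * (N (w n) * β) ≤ (w n).im * 1 := by
      linarith
    exact le_of_mul_le_mul_left h2 (hwi n)
  have hbdd : ∀ n, w n ∈ Metric.closedBall (0 : ℂ) (|a| + 1 + β * (1 + 1 / β)) := by
    intro n
    have hM : ‖cauchyT μ (w n)‖ ≤ 1 + 1 / β := by
      calc ‖cauchyT μ (w n)‖ ≤ ∫ t : ℝ, (1 + ‖((t : ℂ) - w n)⁻¹‖ ^ 2) ∂μ := by
            refine norm_integral_le_of_norm_le
              ((integrable_const _).add (integrable_norm_inv_sq μ (hwi n))) (ae_of_all _ fun t => ?_)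
            nlinarith [sq_nonneg (‖((t : ℂ) - w n)⁻¹‖ - 1), norm_nonneg ((t : ℂ) - w n)⁻¹]
        _ = 1 + N (w n) := by
            rw [integral_add (integrable_const _) (integrable_norm_inv_sq μ (hwi n))]
            simp [hN]
        _ ≤ _ := by gcongr; exact hNle n
    rw [mem_closedBall_zero_iff]
    calc ‖w n‖ = ‖(a : ℂ) + ε n * I + β * cauchyT μ (w n)‖ := by rw [hw n]
      _ ≤ ‖(a : ℂ)‖ + ‖ε n * I‖ + ‖β * cauchyT μ (w n)‖ := norm_add₃_le
      _ = |a| + ε n + β * ‖cauchyT μ (w n)‖ := by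
        simp [abs_of_pos (hεpos n), abs_of_pos hβ]
      _ ≤ _ := by gcongr; exact hε1 n
  obtain ⟨l, -, ψ, hψ, hlim⟩ := (isCompact_closedBall (0 : ℂ) _).tendsto_subseq hbdd
  have hl : 0 ≤ l.im :=
    ge_of_tendsto ((continuous_im.tendsto l).comp hlim) (Eventually.of_forall fun n => (hwi _).le)
  have hconv : ∀ x : ℂ, x ≠ 0 → ENNReal.ofReal (‖x⁻¹‖ ^ 2) = (‖x‖ₑ ^ 2)⁻¹ := by
    intro x hx
    rw [ENNReal.ofReal_pow (norm_nonneg _), ofReal_norm, enorm_inv hx, ENNReal.inv_pow]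
  have hfatou : ∫⁻ t : ℝ, (‖(t : ℂ) - l‖ₑ ^ 2)⁻¹ ∂μ ≤ ENNReal.ofReal (1 / β) := by
    have hlimt : ∀ t : ℝ, Tendsto (fun n => (‖(t : ℂ) - w (ψ n)‖ₑ ^ 2)⁻¹) atTop
        (nhds ((‖(t : ℂ) - l‖ₑ ^ 2)⁻¹)) := by
      intro t
      rw [tendsto_inv_iff]
      exact ENNReal.Tendsto.pow (tendsto_const_nhds.sub hlim).enorm
    calc _ = ∫⁻ t : ℝ, liminf (fun n => (‖(t : ℂ) - w (ψ n)‖ₑ ^ 2)⁻¹) atTop ∂μ :=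
          lintegral_congr fun t => (hlimt t).liminf_eq.symm
      _ ≤ liminf (fun n => ∫⁻ t : ℝ, (‖(t : ℂ) - w (ψ n)‖ₑ ^ 2)⁻¹ ∂μ) atTop :=
          lintegral_liminf_le fun n => by fun_prop
      _ ≤ liminf (fun _ : ℕ => ENNReal.ofReal (1 / β)) atTop := by
          refine liminf_le_liminf (Eventually.of_forall fun n => ?_)
          have := ofReal_integral_eq_lintegral_ofReal (integrable_norm_inv_sq μ (hwi (ψ n)))
            (ae_of_all _ fun t => by positivity)
          simp only [hconv _ (ofReal_sub_ne_zero (hwi (ψ n)) _)] at this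
          rw [← this]
          exact ENNReal.ofReal_le_ofReal (hNle _)
      _ = _ := by simp
  have hl0 : ∀ᵐ t : ℝ ∂μ, (t : ℂ) - l ≠ 0 := by
    filter_upwards [ae_lt_top (by fun_prop) (hfatou.trans_lt ENNReal.ofReal_lt_top).ne] with t ht h
    simp [h] at ht
  have hli : ∫⁻ t : ℝ, ENNReal.ofReal (‖((t : ℂ) - l)⁻¹‖ ^ 2) ∂μ ≤ ENNReal.ofReal (1 / β) := by
    refine le_trans (le_of_eq (lintegral_congr_ae ?_)) hfatou
    filter_upwards [hl0] with t ht using hconv _ ht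
  have hgi : Integrable (fun t : ℝ => ‖((t : ℂ) - l)⁻¹‖ ^ 2) μ := by
    refine ⟨by fun_prop, ?_⟩
    rw [hasFiniteIntegral_iff_ofReal (ae_of_all _ fun t => by positivity)]
    exact hli.trans_lt ENNReal.ofReal_lt_top
  have hNl : N l ≤ 1 / β := by
    rw [← ofReal_integral_eq_lintegral_ofReal hgi (ae_of_all _ fun t => by positivity)] at hli
    exact (ENNReal.ofReal_le_ofReal_iff (by positivity)).1 hli
  refine ⟨l, hl, hl0, hgi, ?_, ?_⟩
  · rw [le_div_iff₀ hβ] at hNl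
    linarith
  · have hMlim : Tendsto (fun n => cauchyT μ (w (ψ n))) atTop (nhds (cauchyT μ l)) := by
      rw [tendsto_iff_norm_sub_tendsto_zero]
      have h0 : Tendsto (fun n => ‖w (ψ n) - l‖ * (1 / β)) atTop (nhds 0) := by
        simpa using (tendsto_iff_norm_sub_tendsto_zero.1 hlim).mul_const (1 / β)
      refine squeeze_zero (fun n => norm_nonneg _) (fun n => ?_) h0
      apply le_of_sq_le_sq _ (by positivity)
      refine (norm_cauchyT_sub_sq_le (integrable_norm_inv_sq μ (hwi _)) hgi
        (ae_of_all _ (ofReal_sub_ne_zero (hwi _))) hl0).trans ?_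
      rw [mul_pow, sq (1 / β)]
      have h1 : 0 ≤ N l := integral_nonneg fun t => by positivity
      gcongr
      · exact hNle _
    have hεlim : Tendsto (fun n => ε (ψ n)) atTop (nhds 0) :=
      tendsto_one_div_add_atTop_nhds_zero_nat.comp hψ.tendsto_atTop
    have h1 : Tendsto (fun n => (a : ℂ) + (ε (ψ n) : ℝ) * I + β * cauchyT μ (w (ψ n))) atTop
        (nhds (a + (0 : ℝ) * I + β * cauchyT μ l)) :=
      ((((continuous_ofReal.tendsto 0).comp hεlim).mul_const I).const_add _).add
        (hMlim.const_mul _)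
    simp only [hw] at h1
    simpa using tendsto_nhds_unique h1 hlim

theorem msupport_eq_support (σ : Measure ℝ) : msupport σ = σ.support := by
  ext x
  simp [msupport, Measure.mem_support_iff_forall, pos_iff_ne_zero]

open scoped ComplexConjugate in
theorem exists_cauchyT_factor (μ : Measure ℝ) [IsProbabilityMeasure μ] (a : ℝ) {β : ℝ}
    (hβ : 0 < β) {K : Set ℝ} (hK : IsCompact K) (hμ : μ Kᶜ = 0)
    (hinf : ∀ S : Set ℝ, S.Finite → μ Sᶜ ≠ 0) :
    ∃ (l : ℂ) (ν : Measure ℝ) (L : Set ℝ), 0 ≤ l.im ∧ IsProbabilityMeasure ν ∧ IsCompact L ∧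
      ν Lᶜ = 0 ∧ (∀ S : Set ℝ, S.Finite → ν Sᶜ ≠ 0) ∧
      ∀ z : ℂ, 0 < z.im →
        (z - l) * (z - conj l) * cauchyT ν z = a - z + β * cauchyT μ z := by
  obtain ⟨l, hl, hl0, hgi, hle, hfix⟩ := exists_denjoyWolff_point μ a hβ
  set g : ℝ → ℝ := fun t => ‖((t : ℂ) - l)⁻¹‖ ^ 2 with hg
  have hgm : Measurable g := by fun_prop
  have hg0 : ∀ t, 0 ≤ g t := fun t => by positivity
  set c := 1 - β * ∫ t, g t ∂μ with hc
  have hc0 : 0 ≤ c := by linarith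
  have hcl : c = 0 ∨ l.im = 0 := by
    rcases hl.eq_or_lt with h | h
    · exact Or.inr h.symm
    · left
      have h1 := congrArg Complex.im hfix
      rw [add_im, im_ofReal_mul, cauchyT_im_eq μ h, ofReal_im, zero_add] at h1
      have h2 : l.im * c = 0 := by
        rw [hc]
        linarith
      exact (mul_eq_zero.1 h2).resolve_left h.ne'
  set κ := μ.withDensity (fun t => ENNReal.ofReal (g t)) with hκ
  have hκfin : IsFiniteMeasure κ := isFiniteMeasure_withDensity_ofReal hgi.2
  set ν := ENNReal.ofReal c • Measure.dirac l.re + ENNReal.ofReal β • κ with hν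
  have hνp : IsProbabilityMeasure ν := by
    constructor
    simp only [hν, hκ, Measure.add_apply, Measure.smul_apply, smul_eq_mul, measure_univ, mul_one,
      withDensity_apply _ MeasurableSet.univ, Measure.restrict_univ]
    rw [← ofReal_integral_eq_lintegral_ofReal hgi (ae_of_all _ hg0), ← ENNReal.ofReal_mul hβ.le,
      ← ENNReal.ofReal_add hc0 (mul_nonneg hβ.le (integral_nonneg hg0)), hc, sub_add_cancel,
      ENNReal.ofReal_one]
  refine ⟨l, ν, insert l.re K, hl, hνp, hK.insert _, ?_, ?_, ?_⟩
  · have h1 : κ (insert l.re K)ᶜ = 0 :=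
      withDensity_absolutelyContinuous _ _ (measure_mono_null (by simp [Set.subset_insert]) hμ)
    have h2 : Measure.dirac l.re (insert l.re K)ᶜ = 0 := by
      rw [Measure.dirac_apply' _ (hK.insert _).measurableSet.compl]
      simp
    simp [hν, h1, h2]
  · intro S hS hS0
    have h1 : κ Sᶜ = 0 := by
      simp only [hν, Measure.add_apply, Measure.smul_apply, smul_eq_mul, add_eq_zero,
        mul_eq_zero, ENNReal.ofReal_eq_zero, hβ.not_ge, false_or] at hS0
      exact hS0.2
    apply hinf S hS
    have hac : μ ≪ κ := by
      refine withDensity_absolutelyContinuous' (by fun_prop) ?_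
      filter_upwards [hl0] with t ht
      have : 0 < g t := pow_pos (norm_pos_iff.2 (inv_ne_zero ht)) 2
      simpa using this
    exact hac h1
  · intro z hz
    have hzi := integrable_inv_ofReal_sub κ hz
    have hν1 : cauchyT ν z = c * ((l.re : ℂ) - z)⁻¹ + β * cauchyT κ z := by
      rw [cauchyT, hν, integral_add_measure
        ((integrable_inv_ofReal_sub _ hz).smul_measure ENNReal.ofReal_ne_top)
        (hzi.smul_measure ENNReal.ofReal_ne_top), integral_smul_measure, integral_smul_measure,
        integral_dirac, ENNReal.toReal_ofReal hc0, ENNReal.toReal_ofReal hβ.le]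
      simp [cauchyT]
    have hκ1 : cauchyT κ z = ∫ t : ℝ, g t * ((t : ℂ) - z)⁻¹ ∂μ := by
      rw [cauchyT, hκ, integral_withDensity_eq_integral_toReal_smul (by fun_prop) (by simp)]
      simp only [ENNReal.toReal_ofReal (hg0 _), real_smul]
    have hil := integrable_inv_of_norm_sq hgi
    have hκ2 : (z - l) * (z - conj l) * cauchyT κ z =
        cauchyT μ z - conj (cauchyT μ l) - (z - conj l) * ((∫ t, g t ∂μ : ℝ) : ℂ) := by
      have hconj : conj (cauchyT μ l) = ∫ t : ℝ, conj (((t : ℂ) - l)⁻¹) ∂μ := integral_conj.symm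
      have hilc : Integrable (fun t : ℝ => conj (((t : ℂ) - l)⁻¹)) μ :=
        (conjCLE : ℂ →L[ℝ] ℂ).integrable_comp hil
      have h1 := integrable_inv_ofReal_sub μ hz
      have h3 : Integrable (fun t : ℝ => (z - conj l) * ((g t : ℝ) : ℂ)) μ :=
        hgi.ofReal.const_mul _
      have h2 : Integrable (fun t : ℝ => ((t : ℂ) - z)⁻¹ - conj (((t : ℂ) - l)⁻¹)) μ := h1.sub hilc
      rw [hκ1, hconj, cauchyT, ← integral_complex_ofReal, ← integral_const_mul, ← integral_const_mul,
        ← integral_sub h1 hilc, ← integral_sub h2 h3]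
      apply integral_congr_ae
      filter_upwards [hl0] with t ht
      have hzt := ofReal_sub_ne_zero hz t
      have hgt : ((g t : ℝ) : ℂ) = ((t : ℂ) - l)⁻¹ * ((t : ℂ) - conj l)⁻¹ := by
        have h3 : ((t : ℂ) - conj l)⁻¹ = conj (((t : ℂ) - l)⁻¹) := by simp
        rw [h3, mul_conj, normSq_eq_norm_sq]
      have ht' : (t : ℂ) - conj l ≠ 0 := by
        simpa using (map_ne_zero (starRingEnd ℂ)).2 (sub_ne_zero.2 ht)
      simp only [hgt, map_inv₀, map_sub, conj_ofReal]
      field_simp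
      ring
    have hfixc := congrArg conj hfix
    simp only [map_add, map_mul, conj_ofReal] at hfixc
    have hcc : (c : ℂ) = 1 - β * ((∫ t, g t ∂μ : ℝ) : ℂ) := by
      rw [hc]
      push_cast
      ring
    have hc1 : (c : ℂ) * ((z - l) * (z - conj l) * ((l.re : ℂ) - z)⁻¹) = -c * (z - conj l) := by
      rcases hcl with h | h
      · simp [h]
      · have hlre : l = l.re := Complex.ext (by simp) (by simp [h])
        have hne := ofReal_sub_ne_zero hz l.re
        rw [hlre]
        simp only [conj_ofReal, ofReal_re]
        field_simp
        ring
    rw [hν1]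
    linear_combination β * hκ2 + hc1 - hfixc - (z - conj l) * hcc

/-- Theorem 1, direction (ii) ⇒ (i). -/
theorem stmt_1 (a0 b0 : ℝ) (hb0 : 0 < b0) (t3 t4 : ℝ) (ht : t3 < t4)
    (μ : Measure ℝ) (hprob : IsProbabilityMeasure μ)
    (hμsupp : msupport μ ⊆ Set.Icc t3 t4) (hμinf : (msupport μ).Infinite) :
    ∃ (lamInf : ℂ) (d t1 t2 : ℝ) (σ : Measure ℝ), 0 ≤ lamInf.im ∧ t1 < t2 ∧
      IsFiniteMeasure σ ∧ σ ≠ 0 ∧ msupport σ ⊆ Set.Icc t1 t2 ∧ (msupport σ).Infinite ∧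
      ∀ z : ℂ, 0 < z.im →
        (z - lamInf) * (z - (starRingEnd ℂ) lamInf) =
          -(((a0 : ℂ) - z + (b0 : ℂ) ^ 2 * cauchyT μ z) * (z + (d : ℂ) + cauchyT σ z)) := by
  rw [msupport_eq_support] at hμsupp hμinf
  have hμK : μ (Set.Icc t3 t4)ᶜ = 0 :=
    measure_mono_null (Set.compl_subset_compl.2 hμsupp) Measure.measure_compl_support
  have hμfin : ∀ S : Set ℝ, S.Finite → μ Sᶜ ≠ 0 := fun S hS h =>
    hμinf (hS.subset (Measure.support_subset_of_isClosed hS.isClosed (mem_ae_iff.2 h)))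
  obtain ⟨l, ν, L, hl, hνp, hL, hνL, hνfin, hfac⟩ :=
    exists_cauchyT_factor μ a0 (pow_pos hb0 2) isCompact_Icc hμK hμfin
  obtain ⟨d, σ, M, hσf, hM, hσM, hσfin, hinv⟩ :=
    exists_cauchyT_mul_eq_neg_one ν hL hνL hνfin
  obtain ⟨R, hR⟩ := hM.isBounded.subset_closedBall 0
  have hsupp : σ.support ⊆ M := Measure.support_subset_of_isClosed hM.isClosed (mem_ae_iff.2 hσM)
  refine ⟨l, d, -(|R| + 1), |R| + 1, σ, hl, ?_, hσf, ?_, ?_, ?_, ?_⟩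
  · linarith [abs_nonneg R]
  · rintro rfl
    exact hσfin ∅ Set.finite_empty (by simp)
  · rw [msupport_eq_support]
    intro x hx
    have := hR (hsupp hx)
    rw [mem_closedBall_zero_iff, Real.norm_eq_abs] at this
    exact abs_le.1 (by linarith [le_abs_self R])
  · rw [msupport_eq_support]
    exact fun h => hσfin _ h Measure.measure_compl_support
  · intro z hz
    have h1 := hfac z hz
    push_cast at h1
    linear_combination (z - l) * (z - (starRingEnd ℂ) l) * hinv z hz -
      (z + (d : ℂ) + cauchyT σ z) * h1
end

section
/- Theorem 1, direction (iii) ⇒ (i): there exist λ∞ ∈ ℂ with Im λ∞ ≥ 0, d ∈ ℝ, reals t1 < t2, and a nonzero finite Borel measure σ whose support is an infinite subset of [t1,t2], such that every z ∈ ℂ with Im z > 0 and z ≠ λ∞ lies in the resolvent set of H, and for all such z: −⟨e_0 | (H − z)⁻¹ e_0⟩ · (z − λ∞)(z − conj(λ∞)) = z + d + ∫ dσ(t)/(t−z). -/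
open MeasureTheory Complex Filter

section SpectralMeasure

variable {E : Type*} [NormedAddCommGroup E] [InnerProductSpace ℂ E] [CompleteSpace E]

local notation "⟪" x "," y "⟫" => inner ℂ x y

/-- The positive functional `f ↦ re ⟪v, f(A) v⟫` on continuous functions on the spectrum of `A`. -/
noncomputable def vectorFunctional {A : E →L[ℂ] E} (hA : IsSelfAdjoint A) (v : E) :
    CompactlySupportedContinuousMap (spectrum ℝ A) ℝ →ₚ[ℝ] ℝ :=
  PositiveLinearMap.mk₀
    { toFun := fun f => (⟪v, cfcHom hA (f : C(spectrum ℝ A, ℝ)) v⟫).re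
      map_add' := fun f g => by
        have h : ((f + g : CompactlySupportedContinuousMap (spectrum ℝ A) ℝ) :
          C(spectrum ℝ A, ℝ)) = (f : C(spectrum ℝ A, ℝ)) + (g : C(spectrum ℝ A, ℝ)) := rfl
        rw [h, map_add]
        simp
      map_smul' := fun c f => by
        have h : ((c • f : CompactlySupportedContinuousMap (spectrum ℝ A) ℝ) :
          C(spectrum ℝ A, ℝ)) = c • (f : C(spectrum ℝ A, ℝ)) := rfl
        rw [h, map_smul]
        simp [inner_smul_right_eq_smul] }
    (fun f hf => by
      let g : C(spectrum ℝ A, ℝ) := ⟨fun x => √(f x), by fun_prop⟩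
      have hg : (f : C(spectrum ℝ A, ℝ)) = g * g := by
        ext x
        exact (Real.mul_self_sqrt (hf x)).symm
      have hs := ContinuousLinearMap.isSelfAdjoint_iff_isSymmetric.1 (cfcHom_predicate hA g)
      change 0 ≤ (⟪v, cfcHom hA (f : C(spectrum ℝ A, ℝ)) v⟫).re
      rw [hg, map_mul, mul_apply_eq_comp]
      have h2 := hs v (cfcHom hA g v)
      simp only [ContinuousLinearMap.coe_coe] at h2
      rw [← h2]
      exact inner_self_nonneg (𝕜 := ℂ))

theorem IsSelfAdjoint.conj_inner_apply {A : E →L[ℂ] E} (hA : IsSelfAdjoint A) (x y : E) :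
    ⟪A x, y⟫ = ⟪x, A y⟫ :=
  ContinuousLinearMap.isSelfAdjoint_iff_isSymmetric.1 hA x y

theorem IsSelfAdjoint.inner_apply_self_im {A : E →L[ℂ] E} (hA : IsSelfAdjoint A) (x : E) :
    (⟪x, A x⟫).im = 0 := by
  have h := inner_conj_symm (𝕜 := ℂ) x (A x)
  rw [hA.conj_inner_apply] at h
  exact Complex.conj_eq_iff_im.1 h

theorem IsSelfAdjoint.exists_spectralMeasure {A : E →L[ℂ] E} (hA : IsSelfAdjoint A) (v : E) :
    ∃ (t1 t2 : ℝ) (σ : Measure ℝ), t1 < t2 ∧ IsFiniteMeasure σ ∧ σ (Set.Icc t1 t2)ᶜ = 0 ∧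
      ∀ f : ℝ → ℝ, Continuous f → ⟪v, cfc f A v⟫ = ((∫ t, f t ∂σ : ℝ) : ℂ) := by
  have hcompact : IsCompact (spectrum ℝ A) := by
    exact ContinuousFunctionalCalculus.isCompact_spectrum A
  have : CompactSpace (spectrum ℝ A) := isCompact_iff_compactSpace.1 hcompact
  obtain ⟨R, hR0, hR⟩ := hcompact.isBounded.subset_closedBall_lt 0 0
  let ν := RealRMK.rieszMeasure (vectorFunctional hA v)
  have : IsFiniteMeasure ν := inferInstance
  have hemb : MeasurableEmbedding (Subtype.val : spectrum ℝ A → ℝ) :=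
    MeasurableEmbedding.subtype_coe hcompact.isClosed.measurableSet
  refine ⟨-R, R, ν.map Subtype.val, by linarith, inferInstance, ?_, fun f hf => ?_⟩
  · rw [hemb.map_apply]
    convert measure_empty (μ := ν)
    ext x
    have := hR x.2
    rw [Real.closedBall_eq_Icc] at this
    simpa using this
  · rw [hemb.integral_map, cfc_apply f A hA hf.continuousOn]
    set F : C(spectrum ℝ A, ℝ) := ⟨_, hf.continuousOn.domRestrict⟩
    have h := RealRMK.integral_rieszMeasure (vectorFunctional hA v)
      (CompactlySupportedContinuousMap.continuousMapEquiv F)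
    change ∫ x, f x ∂ν = (⟪v, cfcHom hA F v⟫).re at h
    rw [h]
    apply Complex.ext
    · simp
    · simpa using (cfcHom_predicate hA F).inner_apply_self_im v

theorem IsSelfAdjoint.im_mul_norm_sq {A : E →L[ℂ] E} (hA : IsSelfAdjoint A) (z : ℂ) (x : E) :
    (⟪(A - z • 1) x, x⟫).im = z.im * ‖x‖ ^ 2 := by
  have h : (A - z • 1) x = A x - z • x := by simp
  have hn : ⟪x, x⟫ = ((‖x‖ ^ 2 : ℝ) : ℂ) := by
    rw [inner_self_eq_norm_sq_to_K]; norm_cast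
  rw [h, inner_sub_left, hA.conj_inner_apply, inner_smul_left, hn,
    Complex.sub_im, hA.inner_apply_self_im, Complex.im_mul_ofReal]
  simp

theorem IsSelfAdjoint.cfc_resolvent {A : E →L[ℂ] E} (hA : IsSelfAdjoint A) {z : ℂ}
    (hz : z.im ≠ 0) :
    IsUnit (A - z • 1) ∧ Ring.inverse (A - z • 1) =
      cfc (fun t : ℝ => (t - z.re) / ((t - z.re) ^ 2 + z.im ^ 2)) A +
      I • cfc (fun t : ℝ => z.im / ((t - z.re) ^ 2 + z.im ^ 2)) A := by
  have hpos : ∀ t : ℝ, (t - z.re) ^ 2 + z.im ^ 2 ≠ 0 := fun t => by positivity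
  set f1 : ℝ → ℝ := fun t => (t - z.re) / ((t - z.re) ^ 2 + z.im ^ 2)
  set f2 : ℝ → ℝ := fun t => z.im / ((t - z.re) ^ 2 + z.im ^ 2)
  have hf1 : Continuous f1 := by fun_prop (disch := exact hpos _)
  have hf2 : Continuous f2 := by fun_prop (disch := exact hpos _)
  have hlin : cfc (fun t : ℝ => t - z.re) A = A - (z.re : ℂ) • 1 := by
    rw [cfc_sub .., cfc_id' .., cfc_const .., Algebra.algebraMap_eq_smul_one]
    congr 1
  have hAz : A - z • 1 = cfc (fun t : ℝ => t - z.re) A - (I * z.im) • 1 := by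
    rw [hlin, sub_sub, ← add_smul, mul_comm, Complex.re_add_im]
  have e1 : cfc (fun t : ℝ => t - z.re) A * cfc f1 A + (z.im : ℂ) • cfc f2 A = 1 := by
    have hs : (z.im : ℂ) • cfc f2 A = z.im • cfc f2 A := rfl
    rw [hs, ← cfc_mul .., ← cfc_const_mul .., ← cfc_add .., ← cfc_one ℝ A]
    congr 1
    ext t
    have := hpos t
    simp only [f1, f2, Pi.one_apply]
    field_simp
  have e2 : cfc (fun t : ℝ => t - z.re) A * cfc f2 A = (z.im : ℂ) • cfc f1 A := by
    have hs : (z.im : ℂ) • cfc f1 A = z.im • cfc f1 A := rfl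
    rw [hs, ← cfc_mul .., ← cfc_const_mul ..]
    congr 1
    ext t
    simp only [f1, f2]
    ring
  have hright : (A - z • 1) * (cfc f1 A + I • cfc f2 A) = 1 := by
    rw [hAz, mul_add, sub_mul, sub_mul, mul_smul_comm, e2, mul_smul_comm, smul_mul_assoc,
      smul_mul_assoc, one_mul, one_mul, smul_smul, smul_smul, ← e1]
    have : I * (I * (z.im : ℂ)) = -z.im := by
      rw [← mul_assoc, I_mul_I]; ring
    rw [this]
    module
  have hcomm : Commute (A - z • 1) (cfc f1 A + I • cfc f2 A) := by
    have hA1 : ∀ f : ℝ → ℝ, Commute (A - z • 1) (cfc f A) := fun f => by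
      have h := cfc_commute_cfc id f A
      rw [cfc_id ℝ A] at h
      exact h.sub_left ((Commute.one_left _).smul_left z)
    exact (hA1 f1).add_right ((hA1 f2).smul_right I)
  have hleft : (cfc f1 A + I • cfc f2 A) * (A - z • 1) = 1 := by
    rw [← hcomm.eq, hright]
  have hu : IsUnit (A - z • 1) := ⟨⟨_, _, hright, hleft⟩, rfl⟩
  refine ⟨hu, ?_⟩
  exact Ring.inverse_unit (⟨_, _, hright, hleft⟩ : (E →L[ℂ] E)ˣ)


theorem IsSelfAdjoint.inner_resolvent_eq_cauchyT {A : E →L[ℂ] E} (hA : IsSelfAdjoint A) (v : E)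
    {σ : Measure ℝ} [IsFiniteMeasure σ]
    (hσ : ∀ f : ℝ → ℝ, Continuous f → ⟪v, cfc f A v⟫ = ((∫ t, f t ∂σ : ℝ) : ℂ))
    {z : ℂ} (hz : z.im ≠ 0) :
    ⟪v, Ring.inverse (A - z • 1) v⟫ = cauchyT σ z := by
  have hpos : ∀ t : ℝ, (t - z.re) ^ 2 + z.im ^ 2 ≠ 0 := fun t => by positivity
  have hf1 : Continuous fun t : ℝ => (t - z.re) / ((t - z.re) ^ 2 + z.im ^ 2) := by
    fun_prop (disch := exact hpos _)
  have hf2 : Continuous fun t : ℝ => z.im / ((t - z.re) ^ 2 + z.im ^ 2) := by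
    fun_prop (disch := exact hpos _)
  have hre : ∀ t : ℝ, (((t : ℂ) - z)⁻¹).re = (t - z.re) / ((t - z.re) ^ 2 + z.im ^ 2) := by
    intro t
    simp [Complex.inv_re, Complex.normSq_apply, pow_two]
  have him : ∀ t : ℝ, (((t : ℂ) - z)⁻¹).im = z.im / ((t - z.re) ^ 2 + z.im ^ 2) := by
    intro t
    simp [Complex.inv_im, Complex.normSq_apply, pow_two]
  have hne : ∀ t : ℝ, (t : ℂ) - z ≠ 0 := fun t h => hz (by
    have := congrArg Complex.im h
    simpa using this)
  have hinteg : Integrable (fun t : ℝ => ((t : ℂ) - z)⁻¹) σ := by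
    refine Integrable.of_bound (C := |z.im|⁻¹) ?_ (Eventually.of_forall fun t => ?_)
    · exact Continuous.aestronglyMeasurable (by fun_prop (disch := exact hne _))
    · rw [norm_inv]
      refine inv_anti₀ (abs_pos.2 hz) ?_
      have := Complex.abs_im_le_norm ((t : ℂ) - z)
      simpa using this
  rw [(hA.cfc_resolvent hz).2]
  simp only [add_apply, smul_apply, inner_add_right, inner_smul_right]
  rw [hσ _ hf1, hσ _ hf2, cauchyT, ← integral_re_add_im hinteg]
  simp only [RCLike.re_to_complex, RCLike.im_to_complex, hre, him]
  simp [mul_comm]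

theorem IsSelfAdjoint.norm_aeval_sq {A : E →L[ℂ] E} (hA : IsSelfAdjoint A) (v : E)
    {σ : Measure ℝ}
    (hσ : ∀ f : ℝ → ℝ, Continuous f → ⟪v, cfc f A v⟫ = ((∫ t, f t ∂σ : ℝ) : ℂ))
    (p : Polynomial ℝ) :
    ‖Polynomial.aeval A p v‖ ^ 2 = ∫ t, p.eval t ^ 2 ∂σ := by
  have hcont : Continuous fun t : ℝ => p.eval t := p.continuous
  have hsa : IsSelfAdjoint (Polynomial.aeval A p) := by
    rw [← cfc_polynomial p A]
    exact cfc_predicate _ A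
  have h := hσ (fun t => p.eval t ^ 2) (hcont.pow 2)
  rw [cfc_pow (fun t : ℝ => p.eval t) 2 A hcont.continuousOn, cfc_polynomial p A, pow_two,
    mul_apply_eq_comp, ← hsa.conj_inner_apply] at h
  have hn := inner_self_eq_norm_sq_to_K (𝕜 := ℂ) (Polynomial.aeval A p v)
  rw [h] at hn
  exact (Complex.ofReal_injective (hn.trans (by norm_cast))).symm

theorem measure_compl_msupport (σ : Measure ℝ) : σ (msupport σ)ᶜ = 0 := by
  refine measure_null_of_locally_null _ fun x hx => ?_
  simp only [msupport, Set.mem_compl_iff, Set.mem_ofPred_eq, not_forall, not_not] at hx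
  obtain ⟨U, hU, h0⟩ := hx
  exact ⟨U, mem_nhdsWithin_of_mem_nhds hU, h0⟩

theorem msupport_subset_of_isClosed {σ : Measure ℝ} {s : Set ℝ} (hs : IsClosed s)
    (h : σ sᶜ = 0) : msupport σ ⊆ s := by
  intro x hx
  by_contra hxs
  exact hx _ (hs.isOpen_compl.mem_nhds hxs) h

/-- If no nonzero polynomial in `A` annihilates `v`, the spectral measure of `A` at `v` has
infinite support. -/
theorem IsSelfAdjoint.infinite_msupport {A : E →L[ℂ] E} (hA : IsSelfAdjoint A) (v : E)
    {σ : Measure ℝ}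
    (hσ : ∀ f : ℝ → ℝ, Continuous f → ⟪v, cfc f A v⟫ = ((∫ t, f t ∂σ : ℝ) : ℂ))
    (hv : ∀ p : Polynomial ℝ, p ≠ 0 → Polynomial.aeval A p v ≠ 0) : (msupport σ).Infinite := by
  intro hfin
  let p : Polynomial ℝ := ∏ s ∈ hfin.toFinset, (Polynomial.X - Polynomial.C s)
  have hp : p ≠ 0 := Finset.prod_ne_zero_iff.2 fun s _ => Polynomial.X_sub_C_ne_zero s
  apply hv p hp
  have h := hA.norm_aeval_sq v hσ p
  have h0 : ∫ t, p.eval t ^ 2 ∂σ = 0 := by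
    refine integral_eq_zero_of_ae ?_
    have : ∀ᵐ t ∂σ, t ∈ msupport σ := by
      rw [ae_iff]; exact measure_compl_msupport σ
    filter_upwards [this] with t ht
    have : p.eval t = 0 := by
      rw [Polynomial.eval_prod]
      exact Finset.prod_eq_zero (hfin.mem_toFinset.2 ht) (by simp)
    simp [this]
  rw [h0] at h
  simpa using h

theorem IsSelfAdjoint.inner_sub_smul {A : E →L[ℂ] E} (hA : IsSelfAdjoint A) (z : ℂ) (x y : E) :
    ⟪(A - z • 1) x, y⟫ = ⟪x, (A - (starRingEnd ℂ) z • 1) y⟫ := by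
  simp [hA.conj_inner_apply, mul_comm]

theorem IsSelfAdjoint.apply_resolvent {A : E →L[ℂ] E} (hA : IsSelfAdjoint A) {z : ℂ}
    (hz : z.im ≠ 0) (x : E) : (A - z • 1) (Ring.inverse (A - z • 1) x) = x := by
  rw [← mul_apply_eq_comp, Ring.mul_inverse_cancel _ (hA.cfc_resolvent hz).1,
    one_apply_eq_self]

theorem IsSelfAdjoint.resolvent_apply {A : E →L[ℂ] E} (hA : IsSelfAdjoint A) {z : ℂ}
    (hz : z.im ≠ 0) (x : E) : Ring.inverse (A - z • 1) ((A - z • 1) x) = x := by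
  rw [← mul_apply_eq_comp, Ring.inverse_mul_cancel _ (hA.cfc_resolvent hz).1,
    one_apply_eq_self]

theorem IsSelfAdjoint.im_inner_resolvent {A : E →L[ℂ] E} (hA : IsSelfAdjoint A) {z : ℂ}
    (hz : z.im ≠ 0) (u : E) :
    (⟪u, Ring.inverse (A - z • 1) u⟫).im = z.im * ‖Ring.inverse (A - z • 1) u‖ ^ 2 := by
  rw [← hA.im_mul_norm_sq, hA.apply_resolvent hz]

theorem IsSelfAdjoint.norm_resolvent_conj {A : E →L[ℂ] E} (hA : IsSelfAdjoint A) {z : ℂ}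
    (hz : z.im ≠ 0) (u : E) :
    ‖Ring.inverse (A - (starRingEnd ℂ) z • 1) u‖ = ‖Ring.inverse (A - z • 1) u‖ := by
  have hz' : ((starRingEnd ℂ) z).im ≠ 0 := by simpa using hz
  have h1 := hA.im_inner_resolvent hz u
  have h2 := hA.im_inner_resolvent hz' u
  have h3 := hA.inner_sub_smul z (Ring.inverse (A - z • 1) u)
    (Ring.inverse (A - (starRingEnd ℂ) z • 1) u)
  rw [hA.apply_resolvent hz, hA.apply_resolvent hz', ← inner_conj_symm] at h3
  have h4 : ‖Ring.inverse (A - (starRingEnd ℂ) z • 1) u‖ ^ 2 =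
      ‖Ring.inverse (A - z • 1) u‖ ^ 2 := by
    have h5 := congrArg Complex.im h3
    rw [inner_conj_symm, h2] at h5
    rw [← inner_conj_symm, Complex.conj_im, Complex.conj_im, h1] at h5
    have : z.im * (‖Ring.inverse (A - (starRingEnd ℂ) z • 1) u‖ ^ 2 -
      ‖Ring.inverse (A - z • 1) u‖ ^ 2) = 0 := by linarith
    rcases mul_eq_zero.1 this with h | h
    · exact absurd h hz
    · linarith
  exact (sq_eq_sq₀ (norm_nonneg _) (norm_nonneg _)).1 h4

theorem IsSelfAdjoint.norm_inner_resolvent_sub_le {A : E →L[ℂ] E} (hA : IsSelfAdjoint A) {z w : ℂ}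
    (hz : z.im ≠ 0) (hw : w.im ≠ 0) (u : E) :
    ‖⟪u, Ring.inverse (A - z • 1) u⟫ - ⟪u, Ring.inverse (A - w • 1) u⟫‖ ≤
      ‖z - w‖ * (‖Ring.inverse (A - z • 1) u‖ * ‖Ring.inverse (A - w • 1) u‖) := by
  have hz' : ((starRingEnd ℂ) z).im ≠ 0 := by simpa using hz
  set gz := Ring.inverse (A - z • 1) u
  set gw := Ring.inverse (A - w • 1) u
  set gc := Ring.inverse (A - (starRingEnd ℂ) z • 1) u
  have hgc : ‖gc‖ = ‖gz‖ := hA.norm_resolvent_conj hz u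
  have h1 : (A - z • 1) gz = u := hA.apply_resolvent hz u
  have h2 : (A - w • 1) gw = u := hA.apply_resolvent hw u
  have h3 : (A - (starRingEnd ℂ) z • 1) gc = u := hA.apply_resolvent hz' u
  have key : ⟪u, gz⟫ - ⟪u, gw⟫ = (z - w) * ⟪gc, gw⟫ := by
    have h4 : (A - z • 1) (gz - gw) = (z - w) • gw := by
      rw [map_sub, h1]
      nth_rewrite 1 [← h2]
      simp only [sub_apply, smul_apply, one_apply_eq_self]
      module
    rw [← inner_sub_right]
    nth_rewrite 1 [← h3]
    rw [hA.inner_sub_smul, Complex.conj_conj, h4, inner_smul_right]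
  rw [key, norm_mul, ← hgc]
  gcongr
  exact norm_inner_le_norm _ _

theorem IsSelfAdjoint.im_mul_norm_resolvent_le {A : E →L[ℂ] E} (hA : IsSelfAdjoint A) {z : ℂ}
    (hz : 0 < z.im) (u : E) : z.im * ‖Ring.inverse (A - z • 1) u‖ ≤ ‖u‖ := by
  set g := Ring.inverse (A - z • 1) u with hg
  have h1 := hA.im_inner_resolvent hz.ne' u
  rw [← hg] at h1
  have h2 : z.im * ‖g‖ ^ 2 ≤ ‖u‖ * ‖g‖ := by
    rw [← h1]
    exact (Complex.im_le_norm _).trans (norm_inner_le_norm _ _)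
  rcases (norm_nonneg g).eq_or_lt with h | h
  · rw [← h, mul_zero]; exact norm_nonneg _
  · refine le_of_mul_le_mul_right ?_ h
    linarith

/-- For `ε > 0`, the map `z ↦ α + iε + β² ⟪u, (A - z)⁻¹ u⟫` strictly contracts
`‖z - w‖² / (im z * im w)` and therefore has a fixed point in the upper half-plane. -/
theorem IsSelfAdjoint.exists_fixedPoint {A : E →L[ℂ] E} (hA : IsSelfAdjoint A) {u : E}
    (hu : ‖u‖ = 1) (α : ℝ) {β : ℝ} (hβ : 0 < β) {ε : ℝ} (hε : 0 < ε) :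
    ∃ z : ℂ, 0 < z.im ∧ z = α + ε * I + β ^ 2 * ⟪u, Ring.inverse (A - z • 1) u⟫ := by
  set m : ℂ → ℂ := fun z => ⟪u, Ring.inverse (A - z • 1) u⟫ with hm
  set G : ℂ → ℝ := fun z => ‖Ring.inverse (A - z • 1) u‖ with hG
  set F : ℂ → ℂ := fun z => α + ε * I + β ^ 2 * m z with hF
  have hG0 : ∀ z, 0 ≤ G z := fun z => norm_nonneg _
  have hFim : ∀ z : ℂ, 0 < z.im → (F z).im = ε + β ^ 2 * G z ^ 2 * z.im := by
    intro z hz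
    have : (m z).im = z.im * G z ^ 2 := hA.im_inner_resolvent hz.ne' u
    simp only [hF, ← Complex.ofReal_pow, Complex.add_im, Complex.im_ofReal_mul, this]
    simp
    ring
  have hGle : ∀ z : ℂ, ε ≤ z.im → G z ≤ 1 / ε := by
    intro z hz
    have h := hA.im_mul_norm_resolvent_le (hε.trans_le hz) u
    rw [hu] at h
    rw [le_div_iff₀ hε]
    nlinarith [hG0 z]
  have hFsub : ∀ z w : ℂ, 0 < z.im → 0 < w.im →
      ‖F z - F w‖ ≤ β ^ 2 * (‖z - w‖ * (G z * G w)) := by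
    intro z w hz hw
    have : F z - F w = ((β ^ 2 : ℝ) : ℂ) * (m z - m w) := by
      simp only [hF]; push_cast; ring
    rw [this, norm_mul, Complex.norm_real, Real.norm_of_nonneg (by positivity)]
    gcongr
    exact hA.norm_inner_resolvent_sub_le hz.ne' hw.ne' u
  set M : ℝ := |α| + ε + β ^ 2 * (1 / ε)
  set K : Set ℂ := {z | ε ≤ z.im} ∩ Metric.closedBall 0 M
  have hK : IsCompact K :=
    (isCompact_closedBall _ _).inter_left (isClosed_le continuous_const Complex.continuous_im)
  have hFK : ∀ z : ℂ, ε ≤ z.im → F z ∈ K := by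
    intro z hz
    have hz0 := hε.trans_le hz
    refine ⟨?_, ?_⟩
    · change ε ≤ (F z).im
      rw [hFim z hz0]
      have : 0 ≤ β ^ 2 * G z ^ 2 * z.im := by positivity
      linarith
    · rw [mem_closedBall_zero_iff]
      have hmz : ‖m z‖ ≤ 1 / ε := by
        refine (norm_inner_le_norm _ _).trans ?_
        rw [hu, one_mul]
        exact hGle z hz
      calc ‖F z‖ ≤ ‖(α : ℂ)‖ + ‖(ε : ℂ) * I‖ + ‖(β : ℂ) ^ 2 * m z‖ := norm_add₃_le
        _ = |α| + ε + β ^ 2 * ‖m z‖ := by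
          simp [abs_of_pos hε]
        _ ≤ M := by simp only [M]; gcongr
  have hFcont : ContinuousOn F K := by
    have : LipschitzOnWith (Real.toNNReal (β ^ 2 * (1 / ε * (1 / ε)))) F K := by
      refine LipschitzOnWith.of_dist_le_mul fun z hz w hw => ?_
      rw [dist_eq_norm, dist_eq_norm, Real.coe_toNNReal _ (by positivity)]
      refine (hFsub z w (hε.trans_le hz.1) (hε.trans_le hw.1)).trans ?_
      have := mul_le_mul (hGle z hz.1) (hGle w hw.1) (hG0 w) (by positivity)
      calc β ^ 2 * (‖z - w‖ * (G z * G w))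
          ≤ β ^ 2 * (‖z - w‖ * (1 / ε * (1 / ε))) := by gcongr
        _ = _ := by ring
    exact this.continuousOn
  set S : ℂ → ℝ := fun z => ‖z - F z‖ ^ 2 / (z.im * (F z).im)
  have hpos : ∀ z ∈ K, 0 < z.im := fun z hz => hε.trans_le hz.1
  have hScont : ContinuousOn S K := by
    refine ContinuousOn.div (((continuousOn_id.sub hFcont).norm).pow 2)
      (Complex.continuous_im.continuousOn.mul (Complex.continuous_im.comp_continuousOn hFcont)) ?_
    intro z hz
    exact (mul_pos (hpos z hz) (hpos _ (hFK z hz.1))).ne'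
  obtain ⟨z, hzK, hzmin⟩ := hK.exists_isMinOn ⟨F (ε * I), hFK _ (by simp)⟩ hScont
  refine ⟨z, hpos z hzK, ?_⟩
  by_contra hne
  have hwK : F z ∈ K := hFK z hzK.1
  have hw'K : F (F z) ∈ K := hFK _ hwK.1
  have hle := hzmin hwK
  simp only [Set.mem_ofPred_eq, S] at hle
  set w := F z with hw
  set w' := F w
  have hz0 := hpos z hzK
  have hw0 := hpos w hwK
  have hw'0 := hpos w' hw'K
  have hd : 0 < ‖z - w‖ := norm_pos_iff.2 (sub_ne_zero.2 hne)
  rw [div_le_div_iff₀ (by positivity) (by positivity)] at hle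
  have e1 : w.im = ε + β ^ 2 * G z ^ 2 * z.im := hFim z hz0
  have e2 : w'.im = ε + β ^ 2 * G w ^ 2 * w.im := hFim w hw0
  have e3 : ‖w - w'‖ ≤ β ^ 2 * (‖z - w‖ * (G z * G w)) := hFsub z w hz0 hw0
  have e4 : ‖w - w'‖ ^ 2 ≤ ‖z - w‖ ^ 2 * ((β ^ 2 * G z ^ 2) * (β ^ 2 * G w ^ 2)) := by
    calc ‖w - w'‖ ^ 2 ≤ (β ^ 2 * (‖z - w‖ * (G z * G w))) ^ 2 := by gcongr
      _ = _ := by ring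
  have e5 : (β ^ 2 * G w ^ 2) * ((β ^ 2 * G z ^ 2) * z.im) ≤ (β ^ 2 * G w ^ 2) * w.im := by
    gcongr
    linarith
  have e6 : ‖w - w'‖ ^ 2 * z.im < ‖z - w‖ ^ 2 * w'.im := by
    calc ‖w - w'‖ ^ 2 * z.im
        ≤ ‖z - w‖ ^ 2 * ((β ^ 2 * G z ^ 2) * (β ^ 2 * G w ^ 2)) * z.im := by gcongr
      _ = ‖z - w‖ ^ 2 * ((β ^ 2 * G w ^ 2) * ((β ^ 2 * G z ^ 2) * z.im)) := by ring
      _ ≤ ‖z - w‖ ^ 2 * ((β ^ 2 * G w ^ 2) * w.im) := by gcongr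
      _ < ‖z - w‖ ^ 2 * w'.im := by
        gcongr
        linarith
  nlinarith [mul_lt_mul_of_pos_right e6 hw0]

/-- Existence of a vector of nonpositive type: the limit case `ε → 0` of the fixed-point equation,
obtained by weak compactness of balls. -/
theorem IsSelfAdjoint.exists_nonpositive_eigenvector {A : E →L[ℂ] E} (hA : IsSelfAdjoint A) {u : E}
    (hu : ‖u‖ = 1) (α : ℝ) {β : ℝ} (hβ : 0 < β) :
    ∃ (l : ℂ) (g : E), 0 ≤ l.im ∧ β * ‖g‖ ≤ 1 ∧ (A - l • 1) g = u ∧ l = α + β ^ 2 * ⟪u, g⟫ := by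
  have hex := fun n : ℕ => hA.exists_fixedPoint hu α hβ (ε := 1 / ((n : ℝ) + 1)) (by positivity)
  choose z hz0 hz using hex
  set g : ℕ → E := fun n => Ring.inverse (A - z n • 1) u with hg
  have hgu : ∀ n, (A - z n • 1) (g n) = u := fun n => hA.apply_resolvent (hz0 n).ne' u
  have hgn : ∀ n, β * ‖g n‖ ≤ 1 := by
    intro n
    have h1 := hA.im_inner_resolvent (hz0 n).ne' u
    have h2 := congrArg Complex.im (hz n)
    rw [← Complex.ofReal_pow, Complex.add_im, Complex.im_ofReal_mul, h1] at h2
    have h3 : (0 : ℝ) < 1 / ((n : ℝ) + 1) := by positivity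
    have h4 : ((α : ℂ) + ((1 / ((n : ℝ) + 1) : ℝ) : ℂ) * I).im = 1 / ((n : ℝ) + 1) := by
      rw [Complex.add_im, Complex.im_ofReal_mul]; simp
    rw [h4] at h2
    have h5 : (z n).im * (1 - (β * ‖g n‖) ^ 2) = 1 / ((n : ℝ) + 1) := by
      simp only [hg]; linarith
    have h6 : 0 < 1 - (β * ‖g n‖) ^ 2 := by
      by_contra h
      nlinarith [hz0 n]
    nlinarith [mul_nonneg hβ.le (norm_nonneg (g n))]
  have hgn' : ∀ n, ‖g n‖ ≤ 1 / β := fun n => by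
    rw [le_div_iff₀ hβ, mul_comm]; exact hgn n
  have hzb : ∀ n, z n ∈ Metric.closedBall (0 : ℂ) (|α| + 1 + β ^ 2 * (1 / β)) := by
    intro n
    rw [mem_closedBall_zero_iff]
    have h3 : (0 : ℝ) < 1 / ((n : ℝ) + 1) := by positivity
    have h4 : 1 / ((n : ℝ) + 1) ≤ 1 := by
      rw [div_le_one (by positivity)]; linarith [(Nat.cast_nonneg n : (0 : ℝ) ≤ n)]
    have h5 : ‖⟪u, g n⟫‖ ≤ 1 / β := by
      refine (norm_inner_le_norm _ _).trans ?_
      rw [hu, one_mul]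
      exact hgn' n
    calc ‖z n‖ = _ := congrArg norm (hz n)
      _ ≤ ‖(α : ℂ)‖ + ‖((1 / ((n : ℝ) + 1) : ℝ) : ℂ) * I‖ + ‖(β : ℂ) ^ 2 * ⟪u, g n⟫‖ :=
        norm_add₃_le
      _ = |α| + 1 / ((n : ℝ) + 1) + β ^ 2 * ‖⟪u, g n⟫‖ := by
        rw [norm_mul _ I, Complex.norm_real, Complex.norm_real, Complex.norm_I, norm_mul, norm_pow,
          Complex.norm_real, Real.norm_of_nonneg h3.le, Real.norm_eq_abs, Real.norm_eq_abs, sq_abs,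
          mul_one]
      _ ≤ _ := by gcongr
  let 𝒰 : Ultrafilter ℕ := Filter.hyperfilter ℕ
  have h𝒰 : (𝒰 : Filter ℕ) ≤ atTop := Nat.hyperfilter_le_atTop
  obtain ⟨l, -, hl⟩ := (isCompact_closedBall (0 : ℂ) (|α| + 1 + β ^ 2 * (1 / β))).ultrafilter_le_nhds
    (𝒰.map z)
    (le_principal_iff.2 (show z ⁻¹' _ ∈ (𝒰 : Filter ℕ) from Eventually.of_forall hzb))
  have hl : Tendsto z 𝒰 (nhds l) := hl
  let φ : ℕ → WeakDual ℂ E := fun n =>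
    StrongDual.toWeakDual (InnerProductSpace.toDual ℂ E (g n))
  obtain ⟨ψ, hψmem, hψ⟩ := (WeakDual.isCompact_closedBall (𝕜 := ℂ) (0 : StrongDual ℂ E)
    (1 / β)).ultrafilter_le_nhds (𝒰.map φ) (by
      refine le_principal_iff.2 (show φ ⁻¹' _ ∈ (𝒰 : Filter ℕ) from Eventually.of_forall fun n => ?_)
      simpa [φ] using hgn' n)
  have hψ : Tendsto φ 𝒰 (nhds ψ) := hψ
  set γ : E := (InnerProductSpace.toDual ℂ E).symm (WeakDual.toStrongDual ψ) with hγ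
  have hγn : ‖γ‖ ≤ 1 / β := by
    simpa [hγ] using hψmem
  have hlim : ∀ y, Tendsto (fun n => ⟪g n, y⟫) 𝒰 (nhds ⟪γ, y⟫) := by
    intro y
    have h := ((WeakDual.eval_continuous y).tendsto ψ).comp hψ
    have h2 : ⟪γ, y⟫ = ψ y := by
      rw [hγ, InnerProductSpace.toDual_symm_apply]; rfl
    rw [h2]
    exact h
  have hlim' : ∀ y, Tendsto (fun n => ⟪y, g n⟫) 𝒰 (nhds ⟪y, γ⟫) := by
    intro y
    have h := (Complex.continuous_conj.tendsto _).comp (hlim y)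
    simpa [Function.comp_def, inner_conj_symm] using h
  refine ⟨l, γ, ?_, ?_, ?_, ?_⟩
  · exact ge_of_tendsto ((Complex.continuous_im.tendsto l).comp hl)
      (Eventually.of_forall fun n => (hz0 n).le)
  · rwa [le_div_iff₀ hβ, mul_comm] at hγn
  · refine ext_inner_left ℂ fun y => ?_
    have h1 : Tendsto (fun n => ⟪A y, g n⟫ - z n * ⟪y, g n⟫) 𝒰
        (nhds (⟪A y, γ⟫ - l * ⟪y, γ⟫)) := (hlim' (A y)).sub (hl.mul (hlim' y))
    have h2 : ∀ n, ⟪A y, g n⟫ - z n * ⟪y, g n⟫ = ⟪y, u⟫ := by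
      intro n
      rw [← hgu n]
      simp [hA.conj_inner_apply]
    simp only [h2] at h1
    rw [tendsto_nhds_unique tendsto_const_nhds h1]
    simp [inner_sub_right, inner_smul_right, hA.conj_inner_apply]
  · have h1 : Tendsto (fun n : ℕ => (α : ℂ) + ((1 / ((n : ℝ) + 1) : ℝ) : ℂ) * I
        + β ^ 2 * ⟪u, g n⟫) 𝒰 (nhds (α + ((0 : ℝ) : ℂ) * I + β ^ 2 * ⟪u, γ⟫)) := by
      have h0 : Tendsto (fun n : ℕ => ((1 / ((n : ℝ) + 1) : ℝ) : ℂ)) 𝒰 (nhds ((0 : ℝ) : ℂ)) :=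
        (Complex.continuous_ofReal.tendsto 0).comp
          (tendsto_one_div_add_atTop_nhds_zero_nat.mono_left h𝒰)
      exact (tendsto_const_nhds.add (h0.mul_const I)).add ((hlim' u).const_mul _)
    have h2 := tendsto_nhds_unique (hl.congr hz) h1
    simpa using h2

/-- The compression of `A` to the orthogonal complement of a unit vector `e`, extended by `0`. -/
noncomputable def compress (A : E →L[ℂ] E) (e : E) : E →L[ℂ] E :=
  (1 - InnerProductSpace.rankOne ℂ e e) * A * (1 - InnerProductSpace.rankOne ℂ e e)

omit [CompleteSpace E] in
theorem compress_apply (A : E →L[ℂ] E) (e x : E) :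
    compress A e x = A (x - ⟪e, x⟫ • e) - ⟪e, A (x - ⟪e, x⟫ • e)⟫ • e := by
  simp only [compress, mul_apply_eq_comp, sub_apply, one_apply_eq_self,
    InnerProductSpace.rankOne_apply]

omit [CompleteSpace E] in
theorem compress_apply_of_inner_eq_zero (A : E →L[ℂ] E) {e x : E} (h : ⟪e, x⟫ = 0) :
    compress A e x = A x - ⟪e, A x⟫ • e := by
  simp [compress_apply, h]

omit [CompleteSpace E] in
theorem inner_sub_inner_smul_self {e : E} (he : ‖e‖ = 1) (x : E) : ⟪e, x - ⟪e, x⟫ • e⟫ = 0 := by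
  simp [inner_self_eq_norm_sq_to_K, he]

theorem isSelfAdjoint_compress {A : E →L[ℂ] E} (hA : IsSelfAdjoint A) (e : E) :
    IsSelfAdjoint (compress A e) := by
  have hP : IsSelfAdjoint (1 - InnerProductSpace.rankOne ℂ e e : E →L[ℂ] E) := by
    refine (IsSelfAdjoint.one _).sub (ContinuousLinearMap.isSelfAdjoint_iff_isSymmetric.2 ?_)
    intro x y
    simp [inner_smul_left, inner_smul_right, mul_comm]
  have := hA.conjugate (1 - InnerProductSpace.rankOne ℂ e e : E →L[ℂ] E)
  rwa [hP.star_eq] at this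

/-- The Schur complement formula for the resolvent at a unit vector. -/
theorem IsSelfAdjoint.inner_resolvent_mul_schur {A : E →L[ℂ] E} (hA : IsSelfAdjoint A) {e : E}
    (he : ‖e‖ = 1) {z : ℂ} (hz : z.im ≠ 0) :
    ⟪e, Ring.inverse (A - z • 1) e⟫ * (z - ⟪e, A e⟫ +
      ⟪A e - ⟪e, A e⟫ • e, Ring.inverse (compress A e - z • 1) (A e - ⟪e, A e⟫ • e)⟫) = -1 := by
  have hB := isSelfAdjoint_compress hA e
  set v := A e - ⟪e, A e⟫ • e with hv
  set w := Ring.inverse (compress A e - z • 1) v with hw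
  have hee : ⟪e, e⟫ = 1 := by simp [inner_self_eq_norm_sq_to_K, he]
  have hev : ⟪e, v⟫ = 0 := inner_sub_inner_smul_self he _
  have hz0 : z ≠ 0 := fun h => hz (by simp [h])
  have h1 : compress A e w - z • w = v := by
    have := hB.apply_resolvent hz v
    simpa using this
  have hew : ⟪e, w⟫ = 0 := by
    have h2 := congrArg (fun x => ⟪e, x⟫) h1
    simp only [inner_sub_right, hev, inner_smul_right] at h2
    rw [compress_apply, inner_sub_inner_smul_self he, zero_sub, neg_eq_zero] at h2
    exact (mul_eq_zero.1 h2).resolve_left hz0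
  rw [compress_apply_of_inner_eq_zero A hew] at h1
  have hvw : ⟪e, A w⟫ = ⟪v, w⟫ := by
    rw [hv, inner_sub_left, inner_smul_left, hew, mul_zero, sub_zero, hA.conj_inner_apply]
  have h3 : (A - z • 1) (e - w) = (⟪e, A e⟫ - z - ⟪v, w⟫) • e := by
    have h4 : A w = v + z • w + ⟪v, w⟫ • e := by
      rwa [hvw, sub_eq_iff_eq_add, sub_eq_iff_eq_add] at h1
    have h5 : A e = v + ⟪e, A e⟫ • e := by rw [hv]; abel
    simp only [sub_apply, smul_apply, one_apply_eq_self, map_sub]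
    rw [h4]
    nth_rewrite 1 [h5]
    module
  have h6 := congrArg (fun x => ⟪e, Ring.inverse (A - z • 1) x⟫) h3
  simp only [hA.resolvent_apply hz, map_smul, inner_smul_right, inner_sub_right, hee, hew] at h6
  linear_combination h6

omit [CompleteSpace E] in
theorem exists_monic_aeval_eq_compress_pow {A : E →L[ℂ] E} {e : E} (he : ‖e‖ = 1) (n : ℕ) :
    ⟪e, (compress A e ^ n) (A e - ⟪e, A e⟫ • e)⟫ = 0 ∧
    ∃ q : Polynomial ℂ, q.Monic ∧ q.natDegree = n + 1 ∧
      (compress A e ^ n) (A e - ⟪e, A e⟫ • e) = Polynomial.aeval A q e := by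
  induction n with
  | zero =>
    refine ⟨by simpa using inner_sub_inner_smul_self he _, Polynomial.X - Polynomial.C ⟪e, A e⟫,
      Polynomial.monic_X_sub_C _, Polynomial.natDegree_X_sub_C _, ?_⟩
    simp [Algebra.algebraMap_eq_smul_one]
  | succ n ih =>
    obtain ⟨h0, q, hq, hdeg, hqe⟩ := ih
    have h1 : (compress A e ^ (n + 1)) (A e - ⟪e, A e⟫ • e) =
        A (Polynomial.aeval A q e) - ⟪e, A (Polynomial.aeval A q e)⟫ • e := by
      rw [pow_succ', mul_apply_eq_comp, compress_apply_of_inner_eq_zero A h0, hqe]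
    have hlt : (Polynomial.C ⟪e, A (Polynomial.aeval A q e)⟫).degree <
        (Polynomial.X * q).degree := by
      refine Polynomial.degree_C_le.trans_lt ?_
      rw [Polynomial.degree_eq_natDegree (Polynomial.monic_X.mul hq).ne_zero,
        Polynomial.monic_X.natDegree_mul hq, hdeg, Polynomial.natDegree_X]
      norm_cast
      omega
    refine ⟨by rw [h1]; exact inner_sub_inner_smul_self he _,
      Polynomial.X * q - Polynomial.C ⟪e, A (Polynomial.aeval A q e)⟫,
      (Polynomial.monic_X.mul hq).sub_of_left hlt, ?_, ?_⟩
    · rw [Polynomial.natDegree_sub_eq_left_of_natDegree_lt (by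
        rw [Polynomial.natDegree_C, Polynomial.monic_X.natDegree_mul hq, Polynomial.natDegree_X]
        omega), Polynomial.monic_X.natDegree_mul hq, hdeg, Polynomial.natDegree_X]
      omega
    · rw [h1]
      simp [Algebra.algebraMap_eq_smul_one]

omit [CompleteSpace E] in
theorem aeval_compress_ne_zero {A : E →L[ℂ] E} {e : E} (he : ‖e‖ = 1)
    (hcyc : ∀ q : Polynomial ℂ, q ≠ 0 → Polynomial.aeval A q e ≠ 0) (p : Polynomial ℝ)
    (hp : p ≠ 0) : Polynomial.aeval (compress A e) p (A e - ⟪e, A e⟫ • e) ≠ 0 := by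
  choose q hq hdeg hqe using fun n => (exists_monic_aeval_eq_compress_pow (A := A) he n).2
  have hsum : Polynomial.aeval (compress A e) p (A e - ⟪e, A e⟫ • e) = Polynomial.aeval A
      (∑ k ∈ Finset.range (p.natDegree + 1), Polynomial.C (p.coeff k : ℂ) * q k) e := by
    rw [Polynomial.aeval_eq_sum_range, map_sum, sum_apply, sum_apply]
    refine Finset.sum_congr rfl fun k _ => ?_
    rw [smul_apply, hqe, map_mul, Polynomial.aeval_C, Algebra.algebraMap_eq_smul_one]
    simp
  rw [hsum]
  refine hcyc _ fun h0 => ?_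
  have h := congrArg (fun r => Polynomial.coeff r (p.natDegree + 1)) h0
  simp only [Polynomial.finsetSum_coeff, Polynomial.coeff_C_mul, Polynomial.coeff_zero] at h
  rw [Finset.sum_range_succ, Finset.sum_eq_zero, zero_add] at h
  · have hlead : (q p.natDegree).coeff (p.natDegree + 1) = 1 := by
      rw [← hdeg p.natDegree]; exact hq _
    rw [hlead, mul_one] at h
    exact hp (Polynomial.leadingCoeff_eq_zero.1 (by exact_mod_cast h))
  · intro k hk
    have hlt := Finset.mem_range.1 hk
    have hzero : (q k).coeff (p.natDegree + 1) = 0 :=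
      Polynomial.coeff_eq_zero_of_natDegree_lt (by rw [hdeg]; omega)
    rw [hzero, mul_zero]

/-- For a cyclic-like unit vector, `-1 / ⟪e, (A - z)⁻¹ e⟫` has the form `z + d + ∫ dσ(t)/(t - z)`. -/
theorem IsSelfAdjoint.exists_nevanlinna_representation {A : E →L[ℂ] E} (hA : IsSelfAdjoint A)
    {e : E} (he : ‖e‖ = 1) (hcyc : ∀ q : Polynomial ℂ, q ≠ 0 → Polynomial.aeval A q e ≠ 0) :
    ∃ (d t1 t2 : ℝ) (σ : Measure ℝ), t1 < t2 ∧ IsFiniteMeasure σ ∧ σ ≠ 0 ∧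
      msupport σ ⊆ Set.Icc t1 t2 ∧ (msupport σ).Infinite ∧ ∀ z : ℂ, 0 < z.im →
        ⟪e, Ring.inverse (A - z • 1) e⟫ * (z + d + cauchyT σ z) = -1 := by
  have hB := isSelfAdjoint_compress hA e
  obtain ⟨t1, t2, σ, ht, hfin, hsupp, hσ⟩ := hB.exists_spectralMeasure (A e - ⟪e, A e⟫ • e)
  have hinf := hB.infinite_msupport _ hσ (aeval_compress_ne_zero he hcyc)
  refine ⟨-(⟪e, A e⟫).re, t1, t2, σ, ht, hfin, ?_,
    msupport_subset_of_isClosed isClosed_Icc hsupp, hinf, fun z hz => ?_⟩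
  · rintro rfl
    obtain ⟨x, hx⟩ := hinf.nonempty
    exact hx Set.univ Filter.univ_mem (by simp)
  · have h := hA.inner_resolvent_mul_schur he hz.ne'
    rw [hB.inner_resolvent_eq_cauchyT _ hσ hz.ne'] at h
    have hre : (((⟪e, A e⟫).re : ℝ) : ℂ) = ⟪e, A e⟫ :=
      Complex.ext (by simp) (by simp [hA.inner_apply_self_im])
    rw [Complex.ofReal_neg, hre, ← sub_eq_add_neg]
    exact h

/-- The resolvent at `e₀` of the rank-two perturbation `H` of `A` that couples the kernel vector `e₀`
to `e₁` with opposite signs. -/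
theorem IsSelfAdjoint.isUnit_and_inner_resolvent_of_perturbation {A H : E →L[ℂ] E}
    (hA : IsSelfAdjoint A) {e₀ e₁ : E} (h₀ : ‖e₀‖ = 1) (h₀₁ : ⟪e₀, e₁⟫ = 0) (hA₀ : A e₀ = 0)
    {α β : ℂ} (hH : ∀ x, H x = A x + ⟪e₀, x⟫ • (α • e₀ + β • e₁) - (β * ⟪e₁, x⟫) • e₀)
    {z : ℂ} (hz : z.im ≠ 0)
    (hD : α - z + β ^ 2 * ⟪e₁, Ring.inverse (A - z • 1) e₁⟫ ≠ 0) :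
    IsUnit (H - z • 1) ∧ ⟪e₀, Ring.inverse (H - z • 1) e₀⟫ =
      (α - z + β ^ 2 * ⟪e₁, Ring.inverse (A - z • 1) e₁⟫)⁻¹ := by
  have h₀₀ : ⟪e₀, e₀⟫ = 1 := by simp [inner_self_eq_norm_sq_to_K, h₀]
  have h₁₀ : ⟪e₁, e₀⟫ = 0 := inner_eq_zero_symm.1 h₀₁
  have hz0 : z ≠ 0 := fun h => hz (by simp [h])
  have hperp : ∀ x, ⟪e₀, (A - z • 1) x⟫ = -(z * ⟪e₀, x⟫) := fun x => by
    simp [← hA.conj_inner_apply, hA₀]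
  set w := Ring.inverse (A - z • 1) e₁ with hw
  set D := α - z + β ^ 2 * ⟪e₁, w⟫ with hDdef
  have hw1 : (A - z • 1) w = e₁ := hA.apply_resolvent hz e₁
  have hw0 : ⟪e₀, w⟫ = 0 := by
    have h := hperp w
    rw [hw1, h₀₁, zero_eq_neg] at h
    exact (mul_eq_zero.1 h).resolve_left hz0
  have he₀ : (A - z • 1) e₀ = -(z • e₀) := by simp [hA₀]
  have hHz : ∀ x, (H - z • 1) x =
      (A - z • 1) x + ⟪e₀, x⟫ • (α • e₀ + β • e₁) - (β * ⟪e₁, x⟫) • e₀ := fun x => by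
    simp only [sub_apply, smul_apply, one_apply_eq_self, hH]
    abel
  have hunit : IsUnit (H - z • 1) := by
    refine ContinuousLinearMap.isUnit_iff_bijective.2 ⟨?_, fun y => ?_⟩
    · refine (injective_iff_map_eq_zero (H - z • 1)).2 fun x hx => ?_
      rw [hHz] at hx
      have hx0 := congrArg (fun y => ⟪e₀, y⟫) hx
      simp only [inner_sub_right, inner_add_right, inner_smul_right, hperp, h₀₀, h₀₁,
        inner_zero_right] at hx0
      have hx1 : (A - z • 1) (x - (⟪e₀, x⟫ • e₀ - (⟪e₀, x⟫ * β) • w)) = 0 := by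
        rw [map_sub, map_sub, map_smul, map_smul, he₀, hw1]
        have hc : (A - z • 1) x = (β * ⟪e₁, x⟫) • e₀ - ⟪e₀, x⟫ • (α • e₀ + β • e₁) := by
          rw [eq_sub_iff_add_eq, ← sub_eq_zero]; exact hx
        rw [hc]
        have hd : β * ⟪e₁, x⟫ = ⟪e₀, x⟫ * α - z * ⟪e₀, x⟫ := by linear_combination -hx0
        rw [hd]
        module
      have hx2 := congrArg (⇑(Ring.inverse (A - z • (1 : E →L[ℂ] E)))) hx1
      rw [hA.resolvent_apply hz, map_zero, sub_eq_zero] at hx2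
      have hx3 := congrArg (fun y => ⟪e₁, y⟫) hx2
      simp only [inner_sub_right, inner_smul_right, h₁₀] at hx3
      have hx4 : ⟪e₀, x⟫ * D = 0 := by
        rw [hDdef]; linear_combination hx0 + β * hx3
      rw [hx2, (mul_eq_zero.1 hx4).resolve_right hD]
      simp
    · set u := Ring.inverse (A - z • 1) y with hu
      have hu1 : (A - z • 1) u = y := hA.apply_resolvent hz y
      have hu0 : ⟪e₀, y⟫ = -(z * ⟪e₀, u⟫) := by rw [← hperp, hu1]
      obtain ⟨c, hc⟩ : ∃ c, c * D = ⟪e₀, y⟫ + β * ⟪e₁, u⟫ := ⟨_, div_mul_cancel₀ _ hD⟩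
      refine ⟨u - (c * β) • w + (c - ⟪e₀, u⟫) • e₀, ?_⟩
      rw [hHz, map_add, map_sub, map_smul, map_smul, he₀, hw1, hu1]
      simp only [inner_add_right, inner_sub_right, inner_smul_right, hw0, h₀₀, h₁₀]
      have hd : β * (⟪e₁, u⟫ - c * β * ⟪e₁, w⟫) = c * α - z * (c - ⟪e₀, u⟫) := by
        rw [hDdef] at hc; linear_combination -hu0 - hc
      rw [mul_zero, mul_zero, add_zero, sub_zero, hd]
      module
  refine ⟨hunit, ?_⟩
  have hx : (H - z • 1) (D⁻¹ • (e₀ - β • w)) = e₀ := by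
    rw [map_smul, hHz, map_sub, map_smul, he₀, hw1]
    simp only [inner_sub_right, inner_smul_right, hw0, h₀₀, h₁₀]
    rw [inv_smul_eq_iff₀ hD, hDdef]
    module
  have hR : Ring.inverse (H - z • 1) e₀ = D⁻¹ • (e₀ - β • w) := by
    nth_rewrite 1 [← hx]
    rw [← mul_apply_eq_comp, Ring.inverse_mul_cancel _ hunit, one_apply_eq_self]
  rw [hR, inner_smul_right, inner_sub_right, inner_smul_right, hw0, h₀₀]
  ring

omit [CompleteSpace E] in
theorem aeval_apply_of_apply_eq_smul {T : E →L[ℂ] E} {x y : E} {q s : Polynomial ℂ}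
    (h : Polynomial.aeval T s x = y) (hq : Polynomial.aeval T q x = 0) :
    Polynomial.aeval T q y = 0 := by
  rw [← h, ← mul_apply_eq_comp, ← map_mul, mul_comm, map_mul, mul_apply_eq_comp, hq, map_zero]

theorem IsSelfAdjoint.exists_nevanlinna_representation_of_perturbation {A H : E →L[ℂ] E}
    (hA : IsSelfAdjoint A) {e₀ e₁ : E} (h₀ : ‖e₀‖ = 1) (h₁ : ‖e₁‖ = 1) (h₀₁ : ⟪e₀, e₁⟫ = 0)
    (hA₀ : A e₀ = 0) {α β : ℝ} (hβ : 0 < β)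
    (hH : ∀ x, H x = A x + ⟪e₀, x⟫ • ((α : ℂ) • e₀ + (β : ℂ) • e₁) - (β * ⟪e₁, x⟫) • e₀)
    (hcyc : ∀ (r : ℂ) (q : Polynomial ℂ), q ≠ 0 →
      Polynomial.aeval (A + r • InnerProductSpace.rankOne ℂ e₀ e₀) q e₁ ≠ 0) :
    ∃ (l : ℂ) (d t1 t2 : ℝ) (σ : Measure ℝ), 0 ≤ l.im ∧ t1 < t2 ∧
      IsFiniteMeasure σ ∧ σ ≠ 0 ∧ msupport σ ⊆ Set.Icc t1 t2 ∧ (msupport σ).Infinite ∧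
      ∀ z : ℂ, 0 < z.im → z ≠ l → IsUnit (H - z • 1) ∧
        -⟪e₀, Ring.inverse (H - z • 1) e₀⟫ * ((z - l) * (z - (starRingEnd ℂ) l)) =
          z + d + cauchyT σ z := by
  have h₀₀ : ⟪e₀, e₀⟫ = 1 := by simp [inner_self_eq_norm_sq_to_K, h₀]
  have h₁₀ : ⟪e₁, e₀⟫ = 0 := inner_eq_zero_symm.1 h₀₁
  have hAperp : ∀ x, ⟪e₀, A x⟫ = 0 := fun x => by
    rw [← hA.conj_inner_apply, hA₀, inner_zero_left]
  obtain ⟨l, g', hl, hg'n, hg', hlg'⟩ := hA.exists_nonpositive_eigenvector h₁ α hβ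
  obtain ⟨g, hg0, hgn, hg, hlg⟩ : ∃ g, ⟪e₀, g⟫ = 0 ∧ β * ‖g‖ ≤ 1 ∧ (A - l • 1) g = e₁ ∧
      l = α + β ^ 2 * ⟪e₁, g⟫ := by
    have horth : ⟪e₀, g' - ⟪e₀, g'⟫ • e₀⟫ = 0 := inner_sub_inner_smul_self h₀ g'
    refine ⟨g' - ⟪e₀, g'⟫ • e₀, horth, ?_, ?_, ?_⟩
    · refine le_trans (mul_le_mul_of_nonneg_left ?_ hβ.le) hg'n
      have h := norm_add_sq_eq_norm_sq_add_norm_sq_of_inner_eq_zero (𝕜 := ℂ)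
        (g' - ⟪e₀, g'⟫ • e₀) (⟪e₀, g'⟫ • e₀)
        (by rw [inner_smul_right, inner_eq_zero_symm.1 horth, mul_zero])
      rw [sub_add_cancel] at h
      nlinarith [norm_nonneg (g' - ⟪e₀, g'⟫ • e₀), norm_nonneg g',
        mul_self_nonneg ‖⟪e₀, g'⟫ • e₀‖]
    · have h := congrArg (fun x => ⟪e₀, x⟫) hg'
      simp only [sub_apply, smul_apply, one_apply_eq_self, inner_sub_right, inner_smul_right,
        hAperp, h₀₁] at h
      have h' : l * ⟪e₀, g'⟫ = 0 := by linear_combination -h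
      rw [map_sub, hg', map_smul, sub_apply, hA₀, smul_apply, one_apply_eq_self, zero_sub,
        smul_neg, smul_smul, mul_comm, h']
      simp
    · rw [inner_sub_right, inner_smul_right, h₁₀, mul_zero, sub_zero]
      exact hlg'
  set c : ℝ := 1 - β ^ 2 * ‖g‖ ^ 2 with hc
  have hc0 : 0 ≤ c := by
    have := mul_nonneg hβ.le (norm_nonneg g)
    nlinarith
  have hcl : l.im ≠ 0 → c = 0 := by
    intro h
    have h1 := congrArg Complex.im hlg
    have h2 := hA.im_mul_norm_sq l g
    rw [hg] at h2
    rw [← Complex.ofReal_pow, Complex.add_im, Complex.im_ofReal_mul, Complex.ofReal_im, h2] at h1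
    have h3 : l.im * c = 0 := by rw [hc]; linarith
    exact (mul_eq_zero.1 h3).resolve_left h
  have hcl' : (c : ℂ) * (l.re - l) = 0 := by
    by_cases h : l.im = 0
    · rw [show (l.re : ℂ) = l from Complex.ext (by simp) (by simp [h]), sub_self, mul_zero]
    · simp [hcl h]
  have hcl'' : (c : ℂ) * ((starRingEnd ℂ) l - l) = 0 := by
    by_cases h : l.im = 0
    · rw [Complex.conj_eq_iff_im.2 h, sub_self, mul_zero]
    · simp [hcl h]
  set T : E →L[ℂ] E := A + (l.re : ℂ) • InnerProductSpace.rankOne ℂ e₀ e₀ with hT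
  have hTapply : ∀ x, T x = A x + (l.re * ⟪e₀, x⟫) • e₀ := fun x => by
    rw [hT, add_apply, smul_apply, InnerProductSpace.rankOne_apply, smul_smul]
  have hTsa : IsSelfAdjoint T := by
    refine hA.add (ContinuousLinearMap.isSelfAdjoint_iff_isSymmetric.2 fun x y => ?_)
    simp [-Complex.coe_smul, inner_smul_left, inner_smul_right, mul_comm]
  have hT0 : T e₀ = (l.re : ℂ) • e₀ := by rw [hTapply, hA₀, h₀₀, mul_one, zero_add]
  have hTperp : ∀ x, ⟪e₀, x⟫ = 0 → T x = A x := fun x hx => by simp [hTapply, hx]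
  have hTg : T g = e₁ + l • g := by
    rw [hTperp g hg0, ← hg]
    simp
  set s : ℂ := (Real.sqrt c : ℂ) with hs
  have hss : s * s = c := by rw [hs, ← Complex.ofReal_mul, Real.mul_self_sqrt hc0]
  set e : E := (β : ℂ) • g + s • e₀ with he
  have hen : ‖e‖ = 1 := by
    have h := norm_add_sq_eq_norm_sq_add_norm_sq_of_inner_eq_zero (𝕜 := ℂ) ((β : ℂ) • g) (s • e₀)
      (by rw [inner_smul_left, inner_smul_right, inner_eq_zero_symm.1 hg0, mul_zero, mul_zero])
    rw [← he, norm_smul, norm_smul, h₀, hs, Complex.norm_real, Complex.norm_real,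
      Real.norm_of_nonneg hβ.le, Real.norm_of_nonneg (Real.sqrt_nonneg _), mul_one,
      Real.mul_self_sqrt hc0, hc] at h
    have h1 : ‖e‖ * ‖e‖ = 1 := by rw [h]; ring
    nlinarith [norm_nonneg e]
  have hcyc' : ∀ q : Polynomial ℂ, q ≠ 0 → Polynomial.aeval T q e ≠ 0 := by
    intro q hq h0
    have hsl : s * (l.re - l) = 0 := by
      have : s * (s * (l.re - l)) = 0 := by rw [← mul_assoc, hss]; exact hcl'
      rcases mul_eq_zero.1 this with h | h
      · rw [h, zero_mul]
      · exact h
    have h1 : Polynomial.aeval T (Polynomial.X - Polynomial.C l) e = (β : ℂ) • e₁ := by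
      simp only [map_sub, Polynomial.aeval_X, Polynomial.aeval_C, Algebra.algebraMap_eq_smul_one,
        sub_apply, smul_apply, one_apply_eq_self, he, map_add, map_smul, hTg, hT0]
      have : s • (l.re : ℂ) • e₀ = s • l • e₀ := by
        rw [smul_smul, smul_smul, sub_eq_zero.1 ((mul_sub s _ _).symm.trans hsl)]
      rw [smul_sub s, this]
      module
    have h2 := aeval_apply_of_apply_eq_smul h1 h0
    rw [map_smul, smul_eq_zero] at h2
    exact hcyc _ q hq (h2.resolve_left (by exact_mod_cast hβ.ne'))
  obtain ⟨d, t1, t2, σ, ht, hfin, hσ0, hsupp, hinf, hrep⟩ :=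
    hTsa.exists_nevanlinna_representation hen hcyc'
  refine ⟨l, d, t1, t2, σ, hl, ht, hfin, hσ0, hsupp, hinf, fun z hz hzl => ?_⟩
  have hz' := hz.ne'
  have hrez : (l.re : ℂ) - z ≠ 0 := fun h => hz' (by simpa using congrArg Complex.im h)
  set p := Ring.inverse (A - z • 1) g with hp
  have hp1 : (A - z • 1) p = g := hA.apply_resolvent hz' g
  have hz0 : z ≠ 0 := fun h => hz' (by simp [h])
  have hp0 : ⟪e₀, p⟫ = 0 := by
    have h := congrArg (fun x => ⟪e₀, x⟫) hp1
    simp only [sub_apply, smul_apply, one_apply_eq_self, inner_sub_right, inner_smul_right, hAperp,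
      hg0, zero_sub, neg_eq_zero] at h
    exact (mul_eq_zero.1 h).resolve_left hz0
  have hRe : Ring.inverse (T - z • 1) e = (β : ℂ) • p + (s / (l.re - z)) • e₀ := by
    have h : (T - z • 1) ((β : ℂ) • p + (s / (l.re - z)) • e₀) = e := by
      have h1 : (T - z • 1) p = g := by
        rw [← hp1, sub_apply, sub_apply, hTperp p hp0]
      have h2 : (T - z • 1) e₀ = (l.re - z) • e₀ := by
        simp [hT0, sub_smul]
      rw [map_add, map_smul, map_smul, h1, h2, smul_smul, div_mul_cancel₀ _ hrez]
    rw [← h, hTsa.resolvent_apply hz']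
  have hF : ⟪e, Ring.inverse (T - z • 1) e⟫ = β ^ 2 * ⟪g, p⟫ + c / (l.re - z) := by
    rw [hRe, he]
    simp only [inner_add_left, inner_add_right, inner_smul_left, inner_smul_right, hp0,
      inner_eq_zero_symm.1 hg0, h₀₀, hs, Complex.conj_ofReal]
    rw [← hss, hs]
    ring
  have hw : Ring.inverse (A - z • 1) e₁ = g + (z - l) • p := by
    have h : (A - z • 1) (g + (z - l) • p) = e₁ := by
      rw [map_add, map_smul, hp1, ← hg]
      simp only [sub_apply, smul_apply, one_apply_eq_self]
      module
    rw [← h, hA.resolvent_apply hz']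
  have hgp : ⟪e₁, p⟫ = ‖g‖ ^ 2 + (z - (starRingEnd ℂ) l) * ⟪g, p⟫ := by
    have h : (A - (starRingEnd ℂ) l • 1) p = g + (z - (starRingEnd ℂ) l) • p := by
      nth_rewrite 1 [← hp1]
      simp only [sub_apply, smul_apply, one_apply_eq_self]
      module
    rw [← hg, hA.inner_sub_smul, h, inner_add_right, inner_smul_right,
      inner_self_eq_norm_sq_to_K]
    rfl
  have hD : (α : ℂ) - z + β ^ 2 * ⟪e₁, Ring.inverse (A - z • 1) e₁⟫ =
      (z - l) * (z - (starRingEnd ℂ) l) * ⟪e, Ring.inverse (T - z • 1) e⟫ := by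
    have hcC : (c : ℂ) = 1 - β ^ 2 * ‖g‖ ^ 2 := by rw [hc]; push_cast; ring
    have h1 : (c : ℂ) / (l.re - z) * (z - (starRingEnd ℂ) l) = -c := by
      rw [div_mul_eq_mul_div, div_eq_iff hrez]
      linear_combination hcl' - hcl''
    rw [hw, hF, inner_add_right, inner_smul_right, hgp]
    linear_combination -hlg - (z - l) * h1 + (z - l) * hcC
  have hrepz := hrep z hz
  set F := ⟪e, Ring.inverse (T - z • 1) e⟫
  have hF0 : F ≠ 0 := fun h => by simp [h] at hrepz
  have hzl1 : z - l ≠ 0 := sub_ne_zero.2 hzl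
  have hzl2 : z - (starRingEnd ℂ) l ≠ 0 := fun h => by
    have := congrArg Complex.im h
    simp at this
    linarith
  have hD0 : (α : ℂ) - z + β ^ 2 * ⟪e₁, Ring.inverse (A - z • 1) e₁⟫ ≠ 0 := by
    rw [hD]
    exact mul_ne_zero (mul_ne_zero hzl1 hzl2) hF0
  obtain ⟨hunit, hval⟩ :=
    hA.isUnit_and_inner_resolvent_of_perturbation h₀ h₀₁ hA₀ hH hz' hD0
  refine ⟨hunit, ?_⟩
  rw [hval, hD]
  field_simp
  linear_combination -hrepz

end SpectralMeasure

section Jacobi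

local notation "ℓ²" => lp (fun _ : ℕ => ℂ) 2

theorem lp_inner_single_one_left (k : ℕ) (x : ℓ²) :
    inner ℂ (lp.single 2 k (1 : ℂ) : ℓ²) x = x k := by
  simp [lp.inner_single_left]

theorem lp_single_one_apply (k j : ℕ) : (lp.single 2 k (1 : ℂ) : ℓ²) j = if j = k then 1 else 0 := by
  simp [lp.single_apply, Pi.single_apply]

theorem norm_lp_single_one (k : ℕ) : ‖(lp.single 2 k (1 : ℂ) : ℓ²)‖ = 1 := by
  rw [lp.norm_single (by norm_num), norm_one]

/-- A bounded real Jacobi matrix defines a self-adjoint operator. -/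
theorem isSelfAdjoint_of_jacobi {a b : ℕ → ℝ} {J : ℓ² →L[ℂ] ℓ²}
    (h0 : ∀ x : ℓ², J x 0 = a 0 * x 0 + b 0 * x 1)
    (hk : ∀ (x : ℓ²) (k : ℕ),
      J x (k + 1) = b k * x k + a (k + 1) * x (k + 1) + b (k + 1) * x (k + 2)) :
    IsSelfAdjoint J := by
  have key : ∀ (k : ℕ) (x : ℓ²), inner ℂ (J (lp.single 2 k 1)) x = J x k := by
    intro k x
    cases k with
    | zero =>
      have : J (lp.single 2 0 1) =
          (a 0 : ℂ) • lp.single 2 0 1 + (b 0 : ℂ) • lp.single 2 1 1 := by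
        ext i
        rcases i with _ | i
        · simp only [h0, lp_single_one_apply, lp.coeFn_add, lp.coeFn_smul, Pi.add_apply,
            Pi.smul_apply, smul_eq_mul]
          grind
        · simp only [hk, lp_single_one_apply, lp.coeFn_add, lp.coeFn_smul, Pi.add_apply,
            Pi.smul_apply, smul_eq_mul]
          grind
      rw [this, h0]
      simp [-Complex.coe_smul, lp_inner_single_one_left, mul_comm]
    | succ k =>
      have : J (lp.single 2 (k + 1) 1) = (b k : ℂ) • lp.single 2 k 1 +
          (a (k + 1) : ℂ) • lp.single 2 (k + 1) 1 + (b (k + 1) : ℂ) • lp.single 2 (k + 2) 1 := by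
        ext i
        rcases i with _ | i
        · simp only [h0, lp_single_one_apply, lp.coeFn_add, lp.coeFn_smul, Pi.add_apply,
            Pi.smul_apply, smul_eq_mul]
          grind
        · simp only [hk, lp_single_one_apply, lp.coeFn_add, lp.coeFn_smul, Pi.add_apply,
            Pi.smul_apply, smul_eq_mul]
          grind
      rw [this, hk]
      simp [-Complex.coe_smul, lp_inner_single_one_left, mul_comm]
  rw [ContinuousLinearMap.isSelfAdjoint_iff']
  ext x k
  rw [← lp_inner_single_one_left, ContinuousLinearMap.adjoint_inner_right, key]

/-- If the off-diagonal entries below row `1` do not vanish, the first basis vector beyond `e₀` is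
annihilated by no nonzero polynomial in the operator. -/
theorem aeval_single_one_ne_zero {a b : ℕ → ℝ} (hb : ∀ k, b (k + 1) ≠ 0) {T : ℓ² →L[ℂ] ℓ²}
    (hT : ∀ (x : ℓ²) (k : ℕ),
      T x (k + 2) = b (k + 1) * x (k + 1) + a (k + 2) * x (k + 2) + b (k + 2) * x (k + 3))
    {q : Polynomial ℂ} (hq : q ≠ 0) : Polynomial.aeval T q (lp.single 2 1 (1 : ℂ)) ≠ 0 := by
  have hpow : ∀ n : ℕ, (∀ j, n + 1 < j → (T ^ n) (lp.single 2 1 (1 : ℂ)) j = 0) ∧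
      (T ^ n) (lp.single 2 1 (1 : ℂ)) (n + 1) ≠ 0 := by
    intro n
    induction n with
    | zero =>
      refine ⟨fun j hj => ?_, ?_⟩
      · rw [pow_zero, one_apply_eq_self, lp_single_one_apply,
          if_neg (by omega)]
      · rw [pow_zero, one_apply_eq_self, lp_single_one_apply]
        simp
    | succ n ih =>
      rw [pow_succ', mul_apply_eq_comp]
      refine ⟨fun j hj => ?_, ?_⟩
      · obtain ⟨i, rfl⟩ : ∃ i, j = i + 2 := ⟨j - 2, by omega⟩
        rw [hT, ih.1 _ (by omega), ih.1 _ (by omega), ih.1 _ (by omega)]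
        simp
      · rw [hT, ih.1 (n + 2) (by omega), ih.1 (n + 3) (by omega)]
        rw [mul_zero, mul_zero, add_zero, add_zero]
        exact mul_ne_zero (Complex.ofReal_ne_zero.2 (hb n)) ih.2
  intro h
  have h1 := congrArg (fun x : ℓ² => x (q.natDegree + 1)) h
  simp only [Polynomial.aeval_eq_sum_range, sum_apply, lp.coeFn_sum,
    smul_apply, Finset.sum_apply, lp.coeFn_smul, Pi.smul_apply,
    lp.coeFn_zero, Pi.zero_apply, smul_eq_mul] at h1
  rw [Finset.sum_range_succ, Finset.sum_eq_zero, zero_add] at h1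
  · exact (mul_ne_zero (Polynomial.leadingCoeff_ne_zero.2 hq) (hpow _).2) h1
  · intro k hk
    have := Finset.mem_range.1 hk
    rw [(hpow k).1 _ (by omega), mul_zero]

end Jacobi

/-- Theorem 1, direction (iii) ⇒ (i). -/
theorem stmt_3
    (a b : ℕ → ℝ) (ha : ∃ C : ℝ, ∀ j, |a j| ≤ C) (hbbd : ∃ C : ℝ, ∀ j, |b j| ≤ C)
    (hb : ∀ j, 0 < b j)
    (H : lp (fun _ : ℕ => ℂ) 2 →L[ℂ] lp (fun _ : ℕ => ℂ) 2)
    (hH0 : ∀ x : lp (fun _ : ℕ => ℂ) 2,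
      (H x : ∀ _ : ℕ, ℂ) 0 = (a 0 : ℂ) * (x : ∀ _ : ℕ, ℂ) 0 - (b 0 : ℂ) * (x : ∀ _ : ℕ, ℂ) 1)
    (hHk : ∀ x : lp (fun _ : ℕ => ℂ) 2, ∀ k : ℕ,
      (H x : ∀ _ : ℕ, ℂ) (k + 1) = (b k : ℂ) * (x : ∀ _ : ℕ, ℂ) k
        + (a (k + 1) : ℂ) * (x : ∀ _ : ℕ, ℂ) (k + 1) + (b (k + 1) : ℂ) * (x : ∀ _ : ℕ, ℂ) (k + 2))
    :
    ∃ (lamInf : ℂ) (d t1 t2 : ℝ) (σ : Measure ℝ), 0 ≤ lamInf.im ∧ t1 < t2 ∧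
      IsFiniteMeasure σ ∧ σ ≠ 0 ∧ msupport σ ⊆ Set.Icc t1 t2 ∧ (msupport σ).Infinite ∧
      ∀ z : ℂ, 0 < z.im → z ≠ lamInf →
        z ∉ spectrum ℂ H ∧
        (-(@inner ℂ _ _ (lp.single 2 0 (1 : ℂ)) (Ring.inverse (H - z • 1) (lp.single 2 0 (1 : ℂ)))))
            * ((z - lamInf) * (z - (starRingEnd ℂ) lamInf))
          = z + (d : ℂ) + cauchyT σ z := by
  set e : ℕ → lp (fun _ : ℕ => ℂ) 2 := fun k => lp.single 2 k 1 with he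
  set A : lp (fun _ : ℕ => ℂ) 2 →L[ℂ] lp (fun _ : ℕ => ℂ) 2 :=
    H - InnerProductSpace.rankOne ℂ ((a 0 : ℂ) • e 0 + (b 0 : ℂ) • e 1) (e 0) +
      (b 0 : ℂ) • InnerProductSpace.rankOne ℂ (e 0) (e 1) with hA
  have hAx : ∀ x, A x = H x - x 0 • ((a 0 : ℂ) • e 0 + (b 0 : ℂ) • e 1) + (b 0 * x 1) • e 0 := by
    intro x
    rw [hA, add_apply, sub_apply,
      smul_apply, InnerProductSpace.rankOne_apply,
      InnerProductSpace.rankOne_apply, lp_inner_single_one_left, lp_inner_single_one_left,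
      smul_smul]
  have hA0 : ∀ x, A x 0 = 0 := by
    intro x
    rw [hAx]
    simp only [he, hH0, lp_single_one_apply, lp.coeFn_add, lp.coeFn_sub, lp.coeFn_smul, Pi.add_apply,
      Pi.sub_apply, Pi.smul_apply, smul_eq_mul]
    simp
    ring
  have hA1 : ∀ x, A x 1 = a 1 * x 1 + b 1 * x 2 := by
    intro x
    rw [hAx]
    simp only [he, hHk _ 0, lp_single_one_apply, lp.coeFn_add, lp.coeFn_sub, lp.coeFn_smul, Pi.add_apply,
      Pi.sub_apply, Pi.smul_apply, smul_eq_mul]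
    simp
    ring
  have hAk : ∀ x k, A x (k + 2) =
      b (k + 1) * x (k + 1) + a (k + 2) * x (k + 2) + b (k + 2) * x (k + 3) := by
    intro x k
    rw [hAx]
    simp only [he, hHk, lp_single_one_apply, lp.coeFn_add, lp.coeFn_sub, lp.coeFn_smul, Pi.add_apply,
      Pi.sub_apply, Pi.smul_apply, smul_eq_mul]
    simp
  have hAsa : IsSelfAdjoint A := by
    refine isSelfAdjoint_of_jacobi (a := Function.update a 0 0) (b := Function.update b 0 0)
      (fun x => by simp [hA0]) fun x k => ?_
    rcases k with _ | k
    · simp [hA1]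
    · simp [hAk]
  have hAe0 : A (e 0) = 0 := by
    ext i
    rcases i with _ | _ | i
    · simp [hA0]
    · simp [hA1, he]
    · simp [hAk, he]
  obtain ⟨l, d, t1, t2, σ, hl, ht, hfin, hσ, hsupp, hinf, hz⟩ :=
    hAsa.exists_nevanlinna_representation_of_perturbation (H := H) (e₀ := e 0) (e₁ := e 1)
      (norm_lp_single_one 0) (norm_lp_single_one 1)
      (by rw [lp_inner_single_one_left, lp_single_one_apply]; simp) hAe0 (α := a 0) (hb 0)
      (fun x => by
        rw [lp_inner_single_one_left, lp_inner_single_one_left, hAx]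
        abel)
      (fun r q hq => aeval_single_one_ne_zero (a := a) (fun k => (hb (k + 1)).ne')
        (fun x k => by
          simp only [add_apply, smul_apply, InnerProductSpace.rankOne_apply, he,
            lp_single_one_apply, lp.coeFn_add, lp.coeFn_smul, Pi.add_apply, Pi.smul_apply,
            smul_eq_mul, hAk]
          simp) hq)
  refine ⟨l, d, t1, t2, σ, hl, ht, hfin, hσ, hsupp, hinf, fun z hz0 hzl => ⟨?_, (hz z hz0 hzl).2⟩⟩
  rw [spectrum.notMem_iff, Algebra.algebraMap_eq_smul_one, ← neg_sub]
  exact (hz z hz0 hzl).1.neg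
end
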